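/- arXiv:2106.09688 — 2 statements merged into one kernel-verified Lean document; each statement's English description precedes it below -/
import Mathlib

section
/- For every integer k ≥ 3 and every constant 0 < η ≤ 1 there exists α > 0 such that the following holds for all sufficiently large n ∈ ℕ: every n-vertex graph G with minimum degree δ(G) ≥ ηn and independence number α(G) ≤ αn contains, for every tree T on k vertices, a T-tiling covering all but at most ⌊1/η⌋(k−1) vertices of G (an η-quasiperfect T-tiling). -/
open Finset

namespace RTT

variable {k n : ℕ}

/-- `S` spans a copy of the `k`-vertex graph `F` in `G`:
there is an injective graph homomorphism from `F` to `G` with image exactly `S`. -/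
def SpansCopy (F : SimpleGraph (Fin k)) (G : SimpleGraph (Fin n))
    (S : Finset (Fin n)) : Prop :=
  ∃ f : Fin k → Fin n, Function.Injective f ∧
    (∀ a b, F.Adj a b → G.Adj (f a) (f b)) ∧ Finset.image f Finset.univ = S

/-- `T` is an `F`-tiling in `G`: a collection of pairwise vertex-disjoint vertex sets,
each spanning a copy of `F`. -/
def IsTiling (F : SimpleGraph (Fin k)) (G : SimpleGraph (Fin n))
    (T : Finset (Finset (Fin n))) : Prop :=
  (∀ S ∈ T, SpansCopy F G S) ∧ ∀ S ∈ T, ∀ S' ∈ T, S ≠ S' → Disjoint S S'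

/-- The induced subgraph of `G` on the vertex set `A` has a perfect `F`-tiling. -/
def PerfTilingOn (F : SimpleGraph (Fin k)) (G : SimpleGraph (Fin n))
    (A : Finset (Fin n)) : Prop :=
  ∃ T : Finset (Finset (Fin n)), IsTiling F G T ∧ T.biUnion id = A

/-- The minimum degree of `G` is at least `x`. -/
def MinDegGE (G : SimpleGraph (Fin n)) (x : ℝ) : Prop :=
  ∀ v : Fin n, x ≤ ((G.neighborSet v).ncard : ℝ)

/-- The `r`-independence number of `G` is at most `x`: every vertex set whose induced
subgraph contains no copy of `K_r` has size at most `x`. -/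
def IndepBound (G : SimpleGraph (Fin n)) (r : ℕ) (x : ℝ) : Prop :=
  ∀ S : Finset (Fin n), (∀ T ⊆ S, ¬ G.IsNClique r T) → (S.card : ℝ) ≤ x

/-- `α*(G) ≤ x`: every bipartite hole of `G` has size at most `x`. -/
def HoleBound (G : SimpleGraph (Fin n)) (x : ℝ) : Prop :=
  ∀ (s : ℕ) (U₁ U₂ : Finset (Fin n)), Disjoint U₁ U₂ → U₁.card = s → U₂.card = s →
    (∀ u ∈ U₁, ∀ v ∈ U₂, ¬ G.Adj u v) → (s : ℝ) ≤ x

/-- `A` is a `ξ`-absorbing set with respect to `V'` (for the `k`-vertex graph `F`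
in the `n`-vertex graph `G`). -/
def IsAbsorbingSet (F : SimpleGraph (Fin k)) (G : SimpleGraph (Fin n)) (ξ : ℝ)
    (V' A : Finset (Fin n)) : Prop :=
  ∀ U : Finset (Fin n), U ⊆ V' \ A → (U.card : ℝ) ≤ ξ * n →
    k ∣ (A ∪ U).card → PerfTilingOn F G (A ∪ U)

/-- `A` is an `(F,t)`-absorber for the `k`-set `S`. -/
def IsAbsorber (F : SimpleGraph (Fin k)) (G : SimpleGraph (Fin n)) (t : ℕ)
    (S A : Finset (Fin n)) : Prop :=
  Disjoint A S ∧ A.card ≤ k ^ 2 * t ∧ PerfTilingOn F G A ∧ PerfTilingOn F G (A ∪ S)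

/-- `S` has a family of at least `x` pairwise vertex-disjoint `(F,t)`-absorbers in `G`. -/
def HasManyAbsorbers (F : SimpleGraph (Fin k)) (G : SimpleGraph (Fin n)) (t : ℕ)
    (S : Finset (Fin n)) (x : ℝ) : Prop :=
  ∃ 𝒜 : Finset (Finset (Fin n)), x ≤ (𝒜.card : ℝ) ∧
    (∀ A ∈ 𝒜, IsAbsorber F G t S A) ∧
    ∀ A ∈ 𝒜, ∀ A' ∈ 𝒜, A ≠ A' → Disjoint A A'

/-- `𝒮` is an `F`-fan at `v` in `U`: a collection of pairwise disjoint `(k-1)`-sets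
`S ⊆ U \ {v}` such that `{v} ∪ S` spans a copy of `F`; its size is `𝒮.card`. -/
def IsFan (F : SimpleGraph (Fin k)) (G : SimpleGraph (Fin n)) (v : Fin n)
    (U : Finset (Fin n)) (𝒮 : Finset (Finset (Fin n))) : Prop :=
  (∀ S ∈ 𝒮, S ⊆ U.erase v ∧ S.card = k - 1 ∧ SpansCopy F G (insert v S)) ∧
    ∀ S ∈ 𝒮, ∀ S' ∈ 𝒮, S ≠ S' → Disjoint S S'

/-- `u` and `v` are `(F, m, t)`-reachable in `G`. -/
def FReachable (F : SimpleGraph (Fin k)) (G : SimpleGraph (Fin n)) (m : ℝ) (t : ℕ)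
    (u v : Fin n) : Prop :=
  ∀ W : Finset (Fin n), (W.card : ℝ) ≤ m →
    ∃ S : Finset (Fin n), Disjoint S W ∧ u ∉ S ∧ v ∉ S ∧ S.card ≤ k * t - 1 ∧
      PerfTilingOn F G (insert u S) ∧ PerfTilingOn F G (insert v S)

/-- `U` is `(F, m, t)`-closed in `G`. -/
def FClosed (F : SimpleGraph (Fin k)) (G : SimpleGraph (Fin n)) (m : ℝ) (t : ℕ)
    (U : Finset (Fin n)) : Prop :=
  ∀ u ∈ U, ∀ v ∈ U, u ≠ v → FReachable F G m t u v

/-- `P` is a partition of the vertex set of an `n`-vertex graph into `C` parts. -/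
def IsPartition {C : ℕ} (P : Fin C → Finset (Fin n)) : Prop :=
  (∀ i j, i ≠ j → Disjoint (P i) (P j)) ∧ Finset.univ.biUnion P = Finset.univ

/-- The `k`-vector `v` is `(F, β)`-robust with respect to the partition `P`:
it has coordinate sum `k`, and avoiding any set `W` of at most `βn` vertices there is
a copy of `F` whose vertex set has index vector `v`. -/
def RobustVec (F : SimpleGraph (Fin k)) (G : SimpleGraph (Fin n)) {C : ℕ}
    (P : Fin C → Finset (Fin n)) (β : ℝ) (v : Fin C → ℕ) : Prop :=
  (∑ i, v i) = k ∧
    ∀ W : Finset (Fin n), (W.card : ℝ) ≤ β * n →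
      ∃ S : Finset (Fin n), Disjoint S W ∧ SpansCopy F G S ∧ ∀ i, (S ∩ P i).card = v i

end RTT

namespace RTT

open scoped Classical in
lemma exists_dense {n : ℕ} (G : SimpleGraph (Fin n)) (k : ℕ) (S : Finset (Fin n)) :
    (∃ S' ⊆ S, S'.Nonempty ∧ ∀ v ∈ S', k ≤ (S'.filter (G.Adj v)).card) ∨
    ∃ I ⊆ S, (∀ x ∈ I, ∀ y ∈ I, ¬ G.Adj x y) ∧ S.card ≤ k * I.card := by
  induction S using Finset.strongInduction with
  | H S ih =>
    by_cases hS : S.Nonempty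
    · by_cases h : ∀ v ∈ S, k ≤ (S.filter (G.Adj v)).card
      · exact Or.inl ⟨S, Finset.Subset.refl _, hS, h⟩
      · push Not at h
        obtain ⟨v, hv, hd⟩ := h
        set S1 := S \ insert v (S.filter (G.Adj v)) with hS1
        have hsub : S1 ⊆ S := Finset.sdiff_subset
        have hss : S1 ⊂ S := by
          refine Finset.ssubset_iff_subset_ne.2 ⟨hsub, fun h => ?_⟩
          have : v ∈ S1 := h ▸ hv
          simp [hS1] at this
        rcases ih S1 hss with ⟨S', h1, h2, h3⟩ | ⟨I, h1, h2, h3⟩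
        · exact Or.inl ⟨S', h1.trans hsub, h2, h3⟩
        · right
          have hvI : v ∉ I := fun h => by
            have := h1 h
            simp [hS1] at this
          have hna : ∀ y ∈ I, ¬ G.Adj v y := fun y hy ha => by
            have := h1 hy
            simp [hS1] at this
            exact this.2.2 this.1 ha
          refine ⟨insert v I, ?_, ?_, ?_⟩
          · exact Finset.insert_subset hv (h1.trans hsub)
          · intro x hx y hy
            rcases Finset.mem_insert.1 hx with hx1 | hx1 <;>
            rcases Finset.mem_insert.1 hy with hy1 | hy1
            · rw [hx1, hy1]; exact G.loopless.irrefl _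
            · rw [hx1]; exact hna y hy1
            · rw [hy1]; exact fun h => hna x hx1 h.symm
            · exact h2 x hx1 y hy1
          · rw [Finset.card_insert_of_notMem hvI]
            have hc : S.card ≤ S1.card + (insert v (S.filter (G.Adj v))).card := by
              exact Finset.card_le_card_sdiff_add_card
            have := Finset.card_insert_le v (S.filter (G.Adj v))
            rw [mul_add]; omega
    · right
      refine ⟨∅, by simp, by simp, ?_⟩
      rw [Finset.not_nonempty_iff_eq_empty.1 hS]; simp

open scoped Classical in
lemma tree_embed {n : ℕ} (G : SimpleGraph (Fin n)) (m : ℕ) (S : Finset (Fin n))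
    (hS : S.Nonempty) (hd : ∀ v ∈ S, m ≤ (S.filter (G.Adj v)).card) :
    ∀ (c : ℕ), c ≤ m → ∀ (V : Type) [Fintype V] (T : SimpleGraph V), Fintype.card V = c →
      T.IsTree → ∃ f : V → Fin n, Function.Injective f ∧
      (∀ a b, T.Adj a b → G.Adj (f a) (f b)) ∧ ∀ a, f a ∈ S := by
  intro c
  induction c with
  | zero =>
    intro _ V _ T hc hT
    have := hT.1.nonempty
    have := Fintype.card_pos (α := V)
    omega
  | succ c ih =>
    intro hm V _ T hc hT
    rcases subsingleton_or_nontrivial V with hV | hV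
    · obtain ⟨s, hs⟩ := hS
      refine ⟨fun _ => s, fun a b _ => Subsingleton.elim _ _, fun a b h => ?_, fun _ => hs⟩
      exact absurd (Subsingleton.elim a b) h.ne
    · obtain ⟨v, hv⟩ := hT.exists_vert_degree_one_of_nontrivial
      have hT' : (T.induce ({v}ᶜ : Set V)).IsTree :=
        ⟨hT.1.induce_compl_singleton_of_degree_eq_one hv, hT.2.induce _⟩
      obtain ⟨w, hw, hw'⟩ := SimpleGraph.degree_eq_one_iff_existsUnique_adj.1 hv
      have hcard : Fintype.card ({v}ᶜ : Set V) = c := by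
        rw [Fintype.card_compl_set]; simp [hc]
      obtain ⟨f, hf1, hf2, hf3⟩ := ih (by omega) _ _ hcard hT'
      have hwv : w ∈ ({v}ᶜ : Set V) := by simpa using hw.ne'
      have hex : ∃ x ∈ S.filter (G.Adj (f ⟨w, hwv⟩)), x ∉ Finset.univ.image f := by
        apply Finset.exists_mem_notMem_of_card_lt_card
        calc _ ≤ c := by rw [← hcard]; exact Finset.card_image_le
          _ < _ := lt_of_lt_of_le (by omega) (hd _ (hf3 _))
      obtain ⟨x, hx, hxf⟩ := hex
      simp only [Finset.mem_filter, Finset.mem_image, Finset.mem_univ, true_and, not_exists] at hx hxf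
      refine ⟨fun a => if h : a = v then x else f ⟨a, by simpa using h⟩, ?_, ?_, ?_⟩
      · intro a b hab
        by_cases ha : a = v <;> by_cases hb : b = v
        · rw [ha, hb]
        · simp [ha, hb] at hab; exact absurd hab.symm (hxf _)
        · simp [ha, hb] at hab; exact absurd hab (hxf _)
        · simp [ha, hb] at hab; simpa using hf1 hab
      · intro a b hab
        by_cases ha : a = v <;> by_cases hb : b = v
        · subst ha; subst hb; exact absurd hab (T.loopless.irrefl _)
        · subst ha
          have := hw' b hab
          subst this
          simp only [dite_true, hb, dite_false]
          exact hx.2.symm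
        · subst hb
          have := hw' a hab.symm
          subst this
          simp only [dite_true, ha, dite_false]
          exact hx.2
        · simp only [ha, hb, dite_false]
          exact hf2 _ _ hab
      · intro a
        by_cases ha : a = v
        · simp [ha, hx.1]
        · simp [ha, hf3]

/-- embedding -/
def IsEmb {k n : ℕ} (Tr : SimpleGraph (Fin k)) (G : SimpleGraph (Fin n)) (f : Fin k → Fin n) : Prop :=
  Function.Injective f ∧ ∀ a b, Tr.Adj a b → G.Adj (f a) (f b)

/-- image -/
def im {k n : ℕ} (f : Fin k → Fin n) : Finset (Fin n) := Finset.univ.image f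

lemma mem_im {k n : ℕ} (f : Fin k → Fin n) (a : Fin k) : f a ∈ im f := by simp [im]

lemma card_im {k n : ℕ} {Tr : SimpleGraph (Fin k)} {G : SimpleGraph (Fin n)} {f : Fin k → Fin n}
    (h : IsEmb Tr G f) : (im f).card = k := by
  rw [im, Finset.card_image_of_injective _ h.1]; simp

lemma find_emb {k n : ℕ} (Tr : SimpleGraph (Fin k)) (hT : Tr.IsTree) (G : SimpleGraph (Fin n))
    (x : ℝ) (hG : IndepBound G 2 x) (S : Finset (Fin n)) (hS : k * x < S.card) :
    ∃ f, IsEmb Tr G f ∧ im f ⊆ S := by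
  classical
  rcases exists_dense G k S with ⟨S', h1, h2, h3⟩ | ⟨I, h1, h2, h3⟩
  · obtain ⟨f, a, b, c⟩ := tree_embed G k S' h2 (fun v hv => by convert h3 v hv) k le_rfl (Fin k) Tr
      (by simp) hT
    refine ⟨f, ⟨a, b⟩, ?_⟩
    intro y hy
    simp only [im, Finset.mem_image, Finset.mem_univ, true_and] at hy
    obtain ⟨i, rfl⟩ := hy
    exact h1 (c i)
  · exfalso
    have := hG I (by
      intro T hT hc
      rw [SimpleGraph.isNClique_iff, Finset.card_eq_two] at hc
      obtain ⟨hc, u, v, huv, rfl⟩ := hc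
      have hu : u ∈ I := hT (by simp)
      have hv : v ∈ I := hT (by simp)
      exact h2 u hu v hv (hc (by simp) (by simp) huv))
    have h4 : (S.card : ℝ) ≤ k * I.card := by exact_mod_cast h3
    have h5 : (k : ℝ) * I.card ≤ k * x := by gcongr
    linarith

lemma perf_union {k n : ℕ} {Tr : SimpleGraph (Fin k)} {G : SimpleGraph (Fin n)}
    {A B : Finset (Fin n)} (hA : PerfTilingOn Tr G A) (hB : PerfTilingOn Tr G B)
    (hAB : Disjoint A B) : PerfTilingOn Tr G (A ∪ B) := by
  obtain ⟨T1, ⟨h1, h2⟩, rfl⟩ := hA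
  obtain ⟨T2, ⟨h3, h4⟩, rfl⟩ := hB
  have key : ∀ S ∈ T1, ∀ S' ∈ T2, Disjoint S S' := fun S hS S' hS' =>
    Disjoint.mono (Finset.subset_biUnion_of_mem id hS) (Finset.subset_biUnion_of_mem id hS') hAB
  refine ⟨T1 ∪ T2, ⟨?_, ?_⟩, ?_⟩
  · intro S hS
    rcases Finset.mem_union.1 hS with h | h
    · exact h1 S h
    · exact h3 S h
  · intro S hS S' hS' hne
    rcases Finset.mem_union.1 hS with h | h <;> rcases Finset.mem_union.1 hS' with h' | h'
    · exact h2 S h S' h' hne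
    · exact key S h S' h'
    · exact (key S' h' S h).symm
    · exact h4 S h S' h' hne
  · exact Finset.union_biUnion

lemma perf_single {k n : ℕ} {Tr : SimpleGraph (Fin k)} {G : SimpleGraph (Fin n)}
    {A : Finset (Fin n)} (hA : SpansCopy Tr G A) : PerfTilingOn Tr G A :=
  ⟨{A}, ⟨by simpa using hA, by simp⟩, by simp⟩

lemma perf_empty {k n : ℕ} {Tr : SimpleGraph (Fin k)} {G : SimpleGraph (Fin n)} :
    PerfTilingOn Tr G ∅ := ⟨∅, ⟨by simp, by simp⟩, by simp⟩

lemma perf_biUnion {k n : ℕ} {Tr : SimpleGraph (Fin k)} {G : SimpleGraph (Fin n)} {ι : Type*}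
    [DecidableEq ι] (s : Finset ι) (A : ι → Finset (Fin n))
    (h : ∀ i ∈ s, PerfTilingOn Tr G (A i))
    (hd : ∀ i ∈ s, ∀ j ∈ s, i ≠ j → Disjoint (A i) (A j)) :
    PerfTilingOn Tr G (s.biUnion A) := by
  induction s using Finset.induction_on with
  | empty => simpa using perf_empty
  | insert a s ha ih =>
    rw [Finset.biUnion_insert]
    refine perf_union (h a (by simp)) (ih (fun i hi => h i (by simp [hi]))
      (fun i hi j hj => hd i (by simp [hi]) j (by simp [hj]))) ?_
    rw [Finset.disjoint_biUnion_right]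
    intro i hi
    exact hd a (by simp) i (by simp [hi]) (fun h => ha (h ▸ hi))

lemma emb_spans {k n : ℕ} {Tr : SimpleGraph (Fin k)} {G : SimpleGraph (Fin n)} {f : Fin k → Fin n}
    (h : IsEmb Tr G f) : SpansCopy Tr G (im f) := ⟨f, h.1, h.2, rfl⟩

lemma swap_spans {k n : ℕ} {Tr : SimpleGraph (Fin k)} {G : SimpleGraph (Fin n)} {f : Fin k → Fin n}
    (h : IsEmb Tr G f) (a0 b0 : Fin k) (hab : ∀ b, Tr.Adj a0 b → b = b0)
    (x : Fin n) (hx : x ∉ (im f).erase (f a0)) (hadj : G.Adj x (f b0)) :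
    SpansCopy Tr G (insert x ((im f).erase (f a0))) := by
  have hx' : ∀ a, a ≠ a0 → f a ≠ x := by
    rintro a ha rfl
    exact hx (Finset.mem_erase.2 ⟨fun h' => ha (h.1 h'), mem_im f a⟩)
  refine ⟨Function.update f a0 x, ?_, ?_, ?_⟩
  · intro a b hab'
    by_cases ha : a = a0 <;> by_cases hb : b = a0
    · rw [ha, hb]
    · subst ha; simp [hb] at hab'; exact absurd hab'.symm (hx' b hb)
    · subst hb; simp [ha] at hab'; exact absurd hab' (hx' a ha)
    · simp [ha, hb] at hab'; exact h.1 hab'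
  · intro a b hT
    by_cases ha : a = a0 <;> by_cases hb : b = a0
    · subst ha; subst hb; exact absurd hT (Tr.loopless.irrefl _)
    · subst ha
      rw [Function.update_self, Function.update_of_ne hb, hab b hT]; exact hadj
    · subst hb
      rw [Function.update_self, Function.update_of_ne ha, hab a hT.symm]; exact hadj.symm
    · rw [Function.update_of_ne ha, Function.update_of_ne hb]; exact h.2 a b hT
  · ext y
    simp only [Finset.mem_image, Finset.mem_univ, true_and, Finset.mem_insert, Finset.mem_erase, im]
    constructor
    · rintro ⟨a, rfl⟩
      by_cases ha : a = a0
      · subst ha; left; simp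
      · right; rw [Function.update_of_ne ha]; exact ⟨fun h' => ha (h.1 h'), a, rfl⟩
    · rintro (rfl | ⟨h1, a, rfl⟩)
      · exact ⟨a0, by simp⟩
      · exact ⟨a, Function.update_of_ne (fun h' => h1 (by rw [h'])) _ _⟩

end RTT

namespace RTT

open scoped Classical in
/-- degree of `u` into the centres of the family `J` -/
noncomputable def dg {k n : ℕ} (G : SimpleGraph (Fin n)) (b0 : Fin k) (J : Finset (Fin k → Fin n))
    (u : Fin n) : ℕ := (J.filter (fun f => G.Adj u (f b0))).card

lemma max_sq (D d : ℝ) : (max (D + d) 0) ^ 2 ≤ (max D 0 + d) ^ 2 := by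
  rcases le_total (D + d) 0 with h | h
  · rw [max_eq_right h]; nlinarith [sq_nonneg (max D 0 + d)]
  · rw [max_eq_left h]
    have : D ≤ max D 0 := le_max_left _ _
    gcongr

open scoped Classical in
lemma choose_X {n : ℕ} (G : SimpleGraph (Fin n)) (η ε : ℝ) (hεη : ε ≤ η)
    (hG : MinDegGE G (η * n)) (hη : η ≤ 1) (w : Fin n → ℝ) (hw : ∀ u, 0 ≤ w u) :
    ε * n ≤ ((Finset.univ.filter (fun x =>
      (η - ε) * ∑ u, w u ≤ ∑ u, if G.Adj u x then w u else 0)).card : ℝ) := by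
  set X := Finset.univ.filter (fun x =>
      (η - ε) * ∑ u, w u ≤ ∑ u, if G.Adj u x then w u else 0) with hX
  set W := ∑ u, w u with hW
  have hW0 : 0 ≤ W := Finset.sum_nonneg (fun u _ => hw u)
  have hdeg : ∀ u, η * n ≤ ((Finset.univ.filter (fun x => G.Adj u x)).card : ℝ) := by
    intro u
    have := hG u
    rw [Set.ncard_eq_toFinset_card'] at this
    convert this using 3
    ext x; simp
  have h1 : η * n * W ≤ ∑ x, ∑ u, if G.Adj u x then w u else 0 := by
    rw [Finset.sum_comm, hW, Finset.mul_sum]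
    refine Finset.sum_le_sum fun u _ => ?_
    rw [← Finset.sum_filter, Finset.sum_const, nsmul_eq_mul]
    exact mul_le_mul_of_nonneg_right (hdeg u) (hw u)
  have h2 : ∑ x, (∑ u, if G.Adj u x then w u else 0) ≤ ∑ x, ((η - ε) * W + if x ∈ X then W else 0) := by
    refine Finset.sum_le_sum fun x _ => ?_
    by_cases hx : x ∈ X
    · rw [if_pos hx]
      have : (∑ u, if G.Adj u x then w u else 0) ≤ W := by
        refine Finset.sum_le_sum fun u _ => ?_
        split_ifs
        · exact le_rfl
        · exact hw u
      nlinarith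
    · rw [if_neg hx, add_zero]
      simp only [hX, Finset.mem_filter, Finset.mem_univ, true_and, not_le] at hx
      exact hx.le
  rw [Finset.sum_add_distrib, Finset.sum_const, ← Finset.sum_filter, Finset.sum_const] at h2
  simp only [Finset.card_univ, Fintype.card_fin, nsmul_eq_mul, Finset.filter_mem_eq_inter,
    Finset.univ_inter] at h2
  rcases hW0.eq_or_lt with h0 | h0
  · have hall : X = Finset.univ := by
      refine Finset.filter_true_of_mem fun x _ => ?_
      rw [← hW, ← h0, mul_zero]
      refine Finset.sum_nonneg fun u _ => ?_
      split_ifs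
      · exact hw u
      · exact le_rfl
    rw [hall]; simp
    have : (0:ℝ) ≤ n := by positivity
    nlinarith
  · have : ε * n * W ≤ X.card * W := by nlinarith
    exact le_of_mul_le_mul_right this h0

/-- A good family -/
def Fam {k n : ℕ} (Tr : SimpleGraph (Fin k)) (G : SimpleGraph (Fin n))
    (J : Finset (Fin k → Fin n)) : Prop :=
  (∀ f ∈ J, IsEmb Tr G f) ∧ ∀ f ∈ J, ∀ g ∈ J, f ≠ g → Disjoint (im f) (im g)

open scoped Classical in
lemma exists_fam {k n : ℕ} (Tr : SimpleGraph (Fin k)) (hT : Tr.IsTree)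
    (G : SimpleGraph (Fin n)) (b0 : Fin k) (η ε x : ℝ) (hε : 0 < ε) (hεη : ε ≤ η) (hη : η ≤ 1)
    (hG : MinDegGE G (η * n)) (hI : IndepBound G 2 x) (M : ℕ)
    (hM : k * x + k * M < ε * n) : ∀ t ≤ M,
    ∃ J : Finset (Fin k → Fin n), Fam Tr G J ∧ J.card = t ∧
      ∑ u, (max ((t : ℝ) * (η - ε) - dg G b0 J u) 0) ^ 2 ≤ (t : ℝ) * n := by
  intro t
  induction t with
  | zero =>
    intro _
    refine ⟨∅, ⟨by simp, by simp⟩, by simp, ?_⟩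
    simp [dg]
  | succ t ih =>
    intro ht
    obtain ⟨J, hJ, hc, hP⟩ := ih (by omega)
    set w : Fin n → ℝ := fun u => max ((t : ℝ) * (η - ε) - dg G b0 J u) 0 with hw
    have hw0 : ∀ u, 0 ≤ w u := fun u => le_max_right _ _
    have hX := choose_X G η ε hεη hG hη w hw0
    set X := Finset.univ.filter (fun x =>
      (η - ε) * ∑ u, w u ≤ ∑ u, if G.Adj u x then w u else 0) with hXdef
    have hU : ((J.biUnion im).card : ℝ) ≤ k * M := by
      have : (J.biUnion im).card ≤ J.card * k :=
        Finset.card_biUnion_le_card_mul _ _ _ (fun f hf => (card_im (hJ.1 f hf)).le)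
      have h2 : J.card * k ≤ k * M := by rw [hc, mul_comm]; gcongr; omega
      exact_mod_cast this.trans h2
    have hXs : (X.card : ℝ) ≤ (X \ J.biUnion im).card + (J.biUnion im).card := by
      exact_mod_cast Finset.card_le_card_sdiff_add_card
    obtain ⟨f, hf, hfX⟩ := find_emb Tr hT G x hI (X \ J.biUnion im) (by linarith)
    have hdis : ∀ g ∈ J, Disjoint (im f) (im g) := by
      intro g hg
      rw [Finset.disjoint_left]
      intro y hy hy'
      exact (Finset.mem_sdiff.1 (hfX hy)).2 (Finset.mem_biUnion.2 ⟨g, hg, hy'⟩)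
    have hfJ : f ∉ J := fun h => by
      have := hdis f h
      rw [disjoint_self] at this
      have h2 := mem_im f b0
      rw [this] at h2
      simp at h2
    refine ⟨insert f J, ⟨?_, ?_⟩, ?_, ?_⟩
    · intro g hg
      rcases Finset.mem_insert.1 hg with rfl | hg
      · exact hf
      · exact hJ.1 g hg
    · intro g hg h hh hne
      rcases Finset.mem_insert.1 hg with hg1 | hg1 <;> rcases Finset.mem_insert.1 hh with hh1 | hh1
      · exact absurd (hg1.trans hh1.symm) hne
      · rw [hg1]; exact hdis h hh1
      · rw [hh1]; exact (hdis g hg1).symm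
      · exact hJ.2 g hg1 h hh1 hne
    · rw [Finset.card_insert_of_notMem hfJ, hc]
    · have hdg : ∀ u, (dg G b0 (insert f J) u : ℝ) = dg G b0 J u + if G.Adj u (f b0) then 1 else 0 := by
        intro u
        rw [dg, dg, Finset.filter_insert]
        split_ifs with h
        · rw [Finset.card_insert_of_notMem (by simp [hfJ])]; push_cast; rfl
        · simp
      set d : Fin n → ℝ := fun u => (η - ε) - if G.Adj u (f b0) then 1 else 0 with hd
      have hstep : ∀ u, (max (((t + 1 : ℕ) : ℝ) * (η - ε) - dg G b0 (insert f J) u) 0) ^ 2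
          ≤ w u ^ 2 + 2 * (w u * d u) + 1 := by
        intro u
        have e1 : ((t + 1 : ℕ) : ℝ) * (η - ε) - dg G b0 (insert f J) u
          = ((t : ℝ) * (η - ε) - dg G b0 J u) + d u := by
          rw [hdg, hd]; push_cast; ring
        rw [e1]
        refine (max_sq _ _).trans ?_
        have hd1 : d u ^ 2 ≤ 1 := by
          rw [sq_le_one_iff_abs_le_one, abs_le]
          simp only [hd]
          split_ifs <;> constructor <;> linarith
        have : (w u + d u) ^ 2 = w u ^ 2 + 2 * (w u * d u) + d u ^ 2 := by ring
        change (w u + d u) ^ 2 ≤ _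
        linarith
      refine (Finset.sum_le_sum fun u _ => hstep u).trans ?_
      rw [Finset.sum_add_distrib, Finset.sum_add_distrib, ← Finset.mul_sum]
      have hwd : ∑ u, w u * d u ≤ 0 := by
        have hfx : f b0 ∈ X := (Finset.mem_sdiff.1 (hfX (mem_im f b0))).1
        simp only [hXdef, Finset.mem_filter, Finset.mem_univ, true_and] at hfx
        have : ∑ u, w u * d u = (η - ε) * ∑ u, w u - ∑ u, if G.Adj u (f b0) then w u else 0 := by
          rw [Finset.mul_sum, ← Finset.sum_sub_distrib]
          refine Finset.sum_congr rfl fun u _ => ?_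
          simp only [hd]
          split_ifs <;> ring
        linarith
      simp only [Finset.sum_const, Finset.card_univ, Fintype.card_fin, nsmul_eq_mul, mul_one]
      push_cast
      linarith

open scoped Classical in
lemma bad_card {k n : ℕ} (G : SimpleGraph (Fin n)) (b0 : Fin k) (η ε : ℝ) (hε : 0 < ε)
    (M : ℕ) (hM : 0 < M) (J : Finset (Fin k → Fin n))
    (hP : ∑ u, (max ((M : ℝ) * (η - ε) - dg G b0 J u) 0) ^ 2 ≤ (M : ℝ) * n) :
    ((Finset.univ.filter (fun u => (dg G b0 J u : ℝ) < (η - 2 * ε) * M)).card : ℝ) * (ε ^ 2 * M) ≤ n := by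
  set B := Finset.univ.filter (fun u => (dg G b0 J u : ℝ) < (η - 2 * ε) * M) with hB
  have hM' : (0:ℝ) < M := by exact_mod_cast hM
  have h1 : ∑ u ∈ B, (ε * M) ^ 2 ≤ ∑ u ∈ B, (max ((M : ℝ) * (η - ε) - dg G b0 J u) 0) ^ 2 := by
    refine Finset.sum_le_sum fun u hu => ?_
    simp only [hB, Finset.mem_filter, Finset.mem_univ, true_and] at hu
    have : ε * M ≤ max ((M : ℝ) * (η - ε) - dg G b0 J u) 0 :=
      le_trans (by nlinarith) (le_max_left _ _)
    gcongr
  have h2 := Finset.sum_le_sum_of_subset_of_nonneg (Finset.subset_univ B)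
    (f := fun u => (max ((M : ℝ) * (η - ε) - dg G b0 J u) 0) ^ 2) (fun _ _ _ => sq_nonneg _)
  rw [Finset.sum_const, nsmul_eq_mul] at h1
  have h3 : (B.card : ℝ) * (ε ^ 2 * M) * M ≤ n * M := by
    calc _ = (B.card : ℝ) * (ε * M) ^ 2 := by ring
      _ ≤ _ := by linarith
  exact le_of_mul_le_mul_right h3 hM'

end RTT

namespace RTT

open scoped Classical in
lemma merge_count {ι : Type} (J : Finset ι) (R : ι → ι → Prop) (a θ : ℝ) (m0 : ℕ)
    (Ys : Finset (Finset ι)) (hne : J.Nonempty) (hY : ∀ Y ∈ Ys, Y ⊆ J ∧ Y.Nonempty)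
    (hdeg : ∀ y ∈ J, a * J.card ≤ ((J.filter (R y)).card : ℝ))
    (hm : Ys.card ≤ m0) (ha : 1 + θ ≤ Ys.card * a) (hθ : 0 < θ) (hm0 : 0 < m0) :
    ∃ Y ∈ Ys, ∃ Y' ∈ Ys, Y ≠ Y' ∧ θ / (4 * m0 ^ 3) * J.card ≤
      ((J.filter (fun j => θ / (4 * m0) * Y.card ≤ ((Y.filter (fun y => R y j)).card : ℝ) ∧
        θ / (4 * m0) * Y'.card ≤ ((Y'.filter (fun y => R y j)).card : ℝ))).card : ℝ) := by
  by_contra hcon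
  push Not at hcon
  have hJ : (0:ℝ) < J.card := by exact_mod_cast hne.card_pos
  have hm0' : (0:ℝ) < m0 := by exact_mod_cast hm0
  have hmR : (Ys.card : ℝ) ≤ m0 := by exact_mod_cast hm
  set κ : ℝ := θ / (4 * m0) with hκ
  have hκ0 : 0 < κ := by positivity
  have hmκ : m0 * κ = θ / 4 := by rw [hκ]; field_simp
  set d : Finset ι → ι → ℝ := fun Y j => ((Y.filter (fun y => R y j)).card : ℝ) / Y.card with hd
  have hYpos : ∀ Y ∈ Ys, (0:ℝ) < Y.card := fun Y h => by exact_mod_cast (hY Y h).2.card_pos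
  have hd0 : ∀ Y j, 0 ≤ d Y j := fun Y j => by simp only [hd]; positivity
  have hd1 : ∀ Y j, d Y j ≤ 1 := fun Y j => by
    simp only [hd]
    apply div_le_one_of_le₀ _ (by positivity)
    exact_mod_cast Finset.card_filter_le _ _
  have low : ∀ Y ∈ Ys, a * J.card ≤ ∑ j ∈ J, d Y j := by
    intro Y h
    have e : ∑ j ∈ J, ((Y.filter (fun y => R y j)).card : ℝ) = ∑ y ∈ Y, ((J.filter (R y)).card : ℝ) := by
      simp only [Finset.card_filter]
      push_cast
      exact Finset.sum_comm
    simp only [hd]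
    rw [← Finset.sum_div, le_div_iff₀ (hYpos Y h), e]
    calc a * J.card * Y.card = ∑ y ∈ Y, a * J.card := by
          rw [Finset.sum_const, nsmul_eq_mul]; ring
      _ ≤ _ := Finset.sum_le_sum fun y hy => hdeg y ((hY Y h).1 hy)
  have low2 : (1 + θ) * J.card ≤ ∑ j ∈ J, ∑ Y ∈ Ys, d Y j := by
    rw [Finset.sum_comm]
    calc (1 + θ) * J.card ≤ Ys.card * a * J.card := by gcongr
      _ = ∑ Y ∈ Ys, a * J.card := by rw [Finset.sum_const, nsmul_eq_mul]; ring
      _ ≤ _ := Finset.sum_le_sum low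
  have up : ∀ j ∈ J, ∑ Y ∈ Ys, d Y j ≤ 1 + θ / 4 +
      ∑ q ∈ Ys.offDiag, if (κ ≤ d q.1 j ∧ κ ≤ d q.2 j) then (m0 : ℝ) else 0 := by
    intro j _
    have hs0 : ∀ q ∈ Ys.offDiag, (0:ℝ) ≤ if (κ ≤ d q.1 j ∧ κ ≤ d q.2 j) then (m0 : ℝ) else 0 := by
      intro q _
      split_ifs <;> positivity
    by_cases hex : ∃ q ∈ Ys.offDiag, κ ≤ d q.1 j ∧ κ ≤ d q.2 j
    · obtain ⟨q, hq, hq2⟩ := hex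
      have h1 := Finset.single_le_sum hs0 hq
      rw [if_pos hq2] at h1
      have h2 : ∑ Y ∈ Ys, d Y j ≤ m0 := by
        calc _ ≤ ∑ Y ∈ Ys, (1:ℝ) := Finset.sum_le_sum fun Y _ => hd1 Y j
          _ ≤ m0 := by simpa using hmR
      linarith
    · have h1 := Finset.sum_nonneg hs0
      have h2 : ∑ Y ∈ Ys, d Y j ≤ 1 + θ / 4 := by
        by_cases hb : ∃ Y ∈ Ys, κ ≤ d Y j
        · obtain ⟨Y, hYs, hYκ⟩ := hb
          rw [← Finset.add_sum_erase _ _ hYs]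
          have : ∑ Y' ∈ Ys.erase Y, d Y' j ≤ ∑ Y' ∈ Ys.erase Y, κ := by
            refine Finset.sum_le_sum fun Y' hY' => ?_
            by_contra hlt
            push Not at hlt
            exact hex ⟨(Y, Y'), by
              simp only [Finset.mem_offDiag]
              exact ⟨hYs, Finset.mem_of_mem_erase hY', (Finset.ne_of_mem_erase hY').symm⟩, hYκ, hlt.le⟩
          rw [Finset.sum_const, nsmul_eq_mul] at this
          have h3 : ((Ys.erase Y).card : ℝ) ≤ m0 := by
            exact_mod_cast (Finset.card_erase_le).trans hm
          have : ((Ys.erase Y).card : ℝ) * κ ≤ m0 * κ := by gcongr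
          linarith [hd1 Y j]
        · push Not at hb
          calc _ ≤ ∑ Y ∈ Ys, κ := Finset.sum_le_sum fun Y h => (hb Y h).le
            _ = Ys.card * κ := by rw [Finset.sum_const, nsmul_eq_mul]
            _ ≤ m0 * κ := by gcongr
            _ ≤ _ := by linarith
      linarith
  have up2 := Finset.sum_le_sum up
  rw [Finset.sum_add_distrib, Finset.sum_const, nsmul_eq_mul] at up2
  have up3 : ∑ q ∈ Ys.offDiag, ∑ j ∈ J, (if (κ ≤ d q.1 j ∧ κ ≤ d q.2 j) then (m0 : ℝ) else 0) ≤
      ∑ q ∈ Ys.offDiag, (θ / (4 * m0 ^ 3) * J.card) * m0 := by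
    refine Finset.sum_le_sum fun q hq => ?_
    rw [Finset.mem_offDiag] at hq
    rw [← Finset.sum_filter, Finset.sum_const, nsmul_eq_mul]
    have := hcon q.1 hq.1 q.2 hq.2.1 hq.2.2
    refine mul_le_mul_of_nonneg_right ?_ hm0'.le
    refine le_trans (le_of_eq ?_) this.le
    congr 2
    refine Finset.filter_congr fun j _ => ?_
    simp only [hd]
    rw [le_div_iff₀ (hYpos _ hq.1), le_div_iff₀ (hYpos _ hq.2.1)]
  rw [Finset.sum_const, nsmul_eq_mul, Finset.sum_comm] at up3
  have hoff : (Ys.offDiag.card : ℝ) ≤ m0 ^ 2 := by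
    have : Ys.offDiag.card ≤ m0 ^ 2 := by
      rw [Finset.offDiag_card, sq]
      exact (Nat.sub_le _ _).trans (Nat.mul_le_mul hm hm)
    exact_mod_cast this
  have : (Ys.offDiag.card : ℝ) * ((θ / (4 * m0 ^ 3) * J.card) * m0) ≤ θ / 4 * J.card := by
    calc _ ≤ (m0:ℝ) ^ 2 * ((θ / (4 * m0 ^ 3) * J.card) * m0) := by gcongr
      _ = _ := by field_simp
  have hpos : 0 < θ * J.card := by positivity
  nlinarith

section pools

variable {k n : ℕ}

/-- all vertices of a family -/
def A (I : Finset (Fin k → Fin n)) : Finset (Fin n) := I.biUnion im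

lemma A_union (I I' : Finset (Fin k → Fin n)) : A (I ∪ I') = A I ∪ A I' :=
  Finset.union_biUnion

lemma A_mono {I I' : Finset (Fin k → Fin n)} (h : I ⊆ I') : A I ⊆ A I' :=
  Finset.biUnion_subset_biUnion_of_subset_left _ h

lemma mem_A {I : Finset (Fin k → Fin n)} {f} (h : f ∈ I) (a : Fin k) : f a ∈ A I :=
  Finset.mem_biUnion.2 ⟨f, h, mem_im f a⟩

lemma A_disj {Tr : SimpleGraph (Fin k)} {G : SimpleGraph (Fin n)} {J I I' : Finset (Fin k → Fin n)}
    (hJ : Fam Tr G J) (h : I ⊆ J) (h' : I' ⊆ J) (hd : Disjoint I I') : Disjoint (A I) (A I') := by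
  rw [A, A, Finset.disjoint_biUnion_left]
  intro f hf
  rw [Finset.disjoint_biUnion_right]
  intro g hg
  exact hJ.2 f (h hf) g (h' hg) (fun e => Finset.disjoint_left.1 hd hf (e ▸ hg))

lemma perf_A {Tr : SimpleGraph (Fin k)} {G : SimpleGraph (Fin n)} {J I : Finset (Fin k → Fin n)}
    (hJ : Fam Tr G J) (h : I ⊆ J) : PerfTilingOn Tr G (A I) := by
  classical
  exact perf_biUnion _ _ (fun f hf => perf_single (emb_spans (hJ.1 f (h hf))))
    (fun f hf g hg => hJ.2 f (h hf) g (h hg))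

/-- `Y` is a robust pool for `u` -/
def Pool (Tr : SimpleGraph (Fin k)) (G : SimpleGraph (Fin n)) (a0 : Fin k)
    (J : Finset (Fin k → Fin n)) (r d : ℕ) (u : Fin n) (Y : Finset (Fin k → Fin n)) : Prop :=
  ∀ j ∈ Y, ∀ D : Finset (Fin k → Fin n), D.card ≤ d → j ∉ D →
    ∃ I ⊆ J, j ∈ I ∧ Disjoint I D ∧ I.card ≤ r ∧
      PerfTilingOn Tr G (insert u ((A I).erase (j a0)))

lemma Pool.mono {Tr : SimpleGraph (Fin k)} {G : SimpleGraph (Fin n)} {a0 : Fin k}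
    {J : Finset (Fin k → Fin n)} {r d r' d' : ℕ} {u : Fin n} {Y : Finset (Fin k → Fin n)}
    (h : Pool Tr G a0 J r d u Y) (hr : r ≤ r') (hd : d' ≤ d) : Pool Tr G a0 J r' d' u Y := by
  intro j hj D hD hjD
  obtain ⟨I, h1, h2, h3, h4, h5⟩ := h j hj D (hD.trans hd) hjD
  exact ⟨I, h1, h2, h3, h4.trans hr, h5⟩

lemma pool_init {Tr : SimpleGraph (Fin k)} {G : SimpleGraph (Fin n)} {a0 b0 : Fin k}
    (hab : ∀ b, Tr.Adj a0 b → b = b0)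
    {J : Finset (Fin k → Fin n)} (hJ : Fam Tr G J) (d : ℕ) (u : Fin n) (hu : u ∉ A J)
    (Y : Finset (Fin k → Fin n)) (hY : Y ⊆ J) (hadj : ∀ y ∈ Y, G.Adj u (y b0)) :
    Pool Tr G a0 J 1 d u Y := by
  intro j hj D hD hjD
  refine ⟨{j}, by simpa using hY hj, by simp, by simpa using hjD, by simp, ?_⟩
  have : A {j} = im j := by simp [A]
  rw [this]
  refine perf_single (swap_spans (hJ.1 j (hY hj)) a0 b0 hab u ?_ (hadj j hj))
  intro h
  exact hu (Finset.mem_biUnion.2 ⟨j, hY hj, Finset.mem_of_mem_erase h⟩)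

open scoped Classical in
lemma pool_step {Tr : SimpleGraph (Fin k)} {G : SimpleGraph (Fin n)} {a0 b0 : Fin k}
    (hab : ∀ b, Tr.Adj a0 b → b = b0)
    {J : Finset (Fin k → Fin n)} (hJ : Fam Tr G J) (r d : ℕ) (u : Fin n) (hu : u ∉ A J)
    (Y Z : Finset (Fin k → Fin n)) (hZ : Z ⊆ J) (hP : Pool Tr G a0 J r (d + 1) u Y)
    (hadj : ∀ z ∈ Z, d + 1 < (Y.filter (fun y => G.Adj (y a0) (z b0))).card) :
    Pool Tr G a0 J (r + 1) d u Z := by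
  intro z hz D hD hzD
  have hc : (insert z D).card ≤ d + 1 := (Finset.card_insert_le _ _).trans (by omega)
  obtain ⟨y, hy, hyD⟩ := Finset.exists_mem_notMem_of_card_lt_card (lt_of_le_of_lt hc (hadj z hz))
  rw [Finset.mem_filter] at hy
  obtain ⟨I, h1, h2, h3, h4, h5⟩ := hP y hy.1 _ hc hyD
  have hzI : z ∉ I := fun h => Finset.disjoint_left.1 h3 h (by simp)
  have hzJ := hZ hz
  have e : A {z} = im z := by simp [A]
  have hdis : Disjoint (im z) (A I) := by
    rw [← e]
    exact A_disj hJ (by simpa using hzJ) h1 (by simpa using hzI)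
  have hya : y a0 ∈ A I := mem_A h2 a0
  have hza : z a0 ∈ im z := mem_im z a0
  have huz : u ∉ im z := fun h => hu (Finset.mem_biUnion.2 ⟨z, hzJ, h⟩)
  have huI : u ∉ A I := fun h => hu (A_mono h1 h)
  rw [Finset.disjoint_left] at hdis
  refine ⟨insert z I, Finset.insert_subset hzJ h1, by simp, ?_, ?_, ?_⟩
  · rw [Finset.disjoint_insert_left]
    exact ⟨hzD, h3.mono_right (Finset.subset_insert _ _)⟩
  · exact (Finset.card_insert_le _ _).trans (by omega)
  · have hs := perf_single (swap_spans (hJ.1 z hzJ) a0 b0 hab (y a0) (fun h =>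
      hdis (Finset.mem_of_mem_erase h) hya) hy.2)
    have := perf_union h5 hs (by
      rw [Finset.disjoint_left]
      intro x
      simp only [Finset.mem_insert, Finset.mem_erase]
      rintro (rfl | ⟨hx1, hx2⟩)
      · rintro (h | h)
        · exact huI (h ▸ hya)
        · exact huz h.2
      · rintro (h | h)
        · exact hx1 h
        · exact hdis h.2 hx2)
    convert this using 1
    have e2 : A (insert z I) = im z ∪ A I := Finset.biUnion_insert
    rw [e2]
    ext x
    simp only [Finset.mem_insert, Finset.mem_erase, Finset.mem_union]
    constructor
    · rintro (h | ⟨h, h' | h'⟩)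
      · tauto
      · tauto
      · by_cases hxy : x = y a0
        · tauto
        · tauto
    · rintro ((h | h) | (h | h))
      · tauto
      · right
        exact ⟨fun hh => hdis (hh ▸ hza) h.2, Or.inr h.2⟩
      · right
        subst h
        exact ⟨fun hh => hdis (hh ▸ hza) hya, Or.inr hya⟩
      · tauto

end pools

end RTT

namespace RTT

section absorb

variable {k n : ℕ}

open scoped Classical in
lemma merge_all {Tr : SimpleGraph (Fin k)} {G : SimpleGraph (Fin n)} {a0 b0 : Fin k}
    (hab : ∀ b, Tr.Adj a0 b → b = b0)
    {J : Finset (Fin k → Fin n)} (hJ : Fam Tr G J) (hne : J.Nonempty) (a θ : ℝ) (c m0 : ℕ)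
    (hdeg : ∀ y ∈ J, a * J.card ≤ (dg G b0 J (y a0) : ℝ))
    (ha : 1 + θ ≤ (c + 1) * a) (hθ : 0 < θ) (hm0 : 0 < m0)
    (U : Finset (Fin n)) (hU : U.card ≤ m0) (hUA : ∀ u ∈ U, u ∉ A J) :
    ∀ (m r d : ℕ) (π : Fin n → Finset (Fin k → Fin n)), (U.image π).card ≤ c + m →
      ((d + m + 2 : ℕ) : ℝ) ≤ θ / (4 * m0) * (θ / (4 * m0 ^ 3) * J.card) →
      (∀ u ∈ U, π u ⊆ J ∧ θ / (4 * m0 ^ 3) * J.card ≤ ((π u).card : ℝ) ∧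
        Pool Tr G a0 J r (d + m) u (π u)) →
      ∃ π' : Fin n → Finset (Fin k → Fin n), (U.image π').card ≤ c ∧
        ∀ u ∈ U, π' u ⊆ J ∧ θ / (4 * m0 ^ 3) * J.card ≤ ((π' u).card : ℝ) ∧
        Pool Tr G a0 J (r + m) d u (π' u) := by
  have hJp : (0:ℝ) < J.card := by exact_mod_cast hne.card_pos
  have hm0' : (0:ℝ) < m0 := by exact_mod_cast hm0
  have hζ : 0 < θ / (4 * m0 ^ 3) * J.card := by positivity
  have ha0 : 0 ≤ a := by
    by_contra h
    push Not at h
    have : ((c:ℝ) + 1) * a ≤ 0 := mul_nonpos_of_nonneg_of_nonpos (by positivity) h.le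
    linarith
  intro m
  induction m with
  | zero => intro r d π h1 _ h2; exact ⟨π, h1, h2⟩
  | succ m ih =>
    intro r d π h1 hd h2
    by_cases hcm : (U.image π).card ≤ c + m
    · obtain ⟨π', e1, e2⟩ := ih (r + 1) d π hcm (le_trans (by push_cast; linarith) hd)
        (fun u hu => ⟨(h2 u hu).1, (h2 u hu).2.1, (h2 u hu).2.2.mono (by omega) (by omega)⟩)
      exact ⟨π', e1, fun u hu => ⟨(e2 u hu).1, (e2 u hu).2.1, (e2 u hu).2.2.mono (by omega) le_rfl⟩⟩
    · push Not at hcm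
      have hYs : ∀ Y ∈ U.image π, Y ⊆ J ∧ Y.Nonempty := by
        intro Y hY
        obtain ⟨u, hu, rfl⟩ := Finset.mem_image.1 hY
        refine ⟨(h2 u hu).1, Finset.card_pos.1 ?_⟩
        exact_mod_cast lt_of_lt_of_le hζ (h2 u hu).2.1
      obtain ⟨Y, hY, Y', hY', hne', hZ⟩ := merge_count J (fun y j => G.Adj (y a0) (j b0)) a θ m0
        (U.image π) hne hYs (fun y hy => by simpa [dg] using hdeg y hy)
        (Finset.card_image_le.trans hU)
        (ha.trans (by
          gcongr
          have : c + 1 ≤ (U.image π).card := by omega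
          exact_mod_cast this)) hθ hm0
      set Z := J.filter (fun j =>
        θ / (4 * m0) * Y.card ≤ ((Y.filter (fun y => G.Adj (y a0) (j b0))).card : ℝ) ∧
        θ / (4 * m0) * Y'.card ≤ ((Y'.filter (fun y => G.Adj (y a0) (j b0))).card : ℝ)) with hZdef
      have hZJ : Z ⊆ J := Finset.filter_subset _ _
      have hbig : ∀ u ∈ U, π u = Y ∨ π u = Y' → Pool Tr G a0 J (r + 1) (d + m) u Z := by
        intro u hu hor
        have hp := (h2 u hu).2.2
        refine pool_step hab hJ r (d + m) u (hUA u hu) (π u) Z hZJ hp ?_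
        intro z hz
        have hz' := (Finset.mem_filter.1 hz).2
        have hlow : θ / (4 * m0) * ((π u).card : ℝ) ≤
            (((π u).filter (fun y => G.Adj (y a0) (z b0))).card : ℝ) := by
          rcases hor with h | h <;> rw [h]
          · exact hz'.1
          · exact hz'.2
        have h3 : θ / (4 * m0) * (θ / (4 * m0 ^ 3) * J.card) ≤ θ / (4 * m0) * ((π u).card : ℝ) := by
          have := (h2 u hu).2.1
          gcongr
        have : ((d + m + 1 + 2 : ℕ) : ℝ) ≤ (((π u).filter (fun y => G.Adj (y a0) (z b0))).card : ℝ) := by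
          refine le_trans ?_ (h3.trans hlow)
          exact hd
        have : d + m + 1 + 2 ≤ ((π u).filter (fun y => G.Adj (y a0) (z b0))).card := by exact_mod_cast this
        omega
      set π1 : Fin n → Finset (Fin k → Fin n) := fun u => if π u = Y ∨ π u = Y' then Z else π u with hπ1
      have hA : (U.image π1).card ≤ c + m := by
        have hsub : U.image π1 ⊆ insert Z (((U.image π).erase Y).erase Y') := by
          intro W hW
          obtain ⟨u, hu, rfl⟩ := Finset.mem_image.1 hW
          simp only [hπ1]
          split_ifs with h
          · simp
          · push Not at h
            simp only [Finset.mem_insert, Finset.mem_erase]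
            exact Or.inr ⟨h.2, h.1, Finset.mem_image_of_mem _ hu⟩
        have c1 := Finset.card_le_card hsub
        have c2 := Finset.card_insert_le Z (((U.image π).erase Y).erase Y')
        have c3 : (((U.image π).erase Y).erase Y').card = (U.image π).card - 1 - 1 := by
          rw [Finset.card_erase_of_mem (Finset.mem_erase.2 ⟨hne'.symm, hY'⟩),
            Finset.card_erase_of_mem hY]
        have c4 : 1 < (U.image π).card := Finset.one_lt_card.2 ⟨Y, hY, Y', hY', hne'⟩
        omega
      have hB : ∀ u ∈ U, π1 u ⊆ J ∧ θ / (4 * m0 ^ 3) * J.card ≤ ((π1 u).card : ℝ) ∧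
          Pool Tr G a0 J (r + 1) (d + m) u (π1 u) := by
        intro u hu
        simp only [hπ1]
        split_ifs with h
        · exact ⟨hZJ, hZ, hbig u hu h⟩
        · exact ⟨(h2 u hu).1, (h2 u hu).2.1, (h2 u hu).2.2.mono (by omega) (by omega)⟩
      obtain ⟨π', e1, e2⟩ := ih (r + 1) d π1 hA (le_trans (by push_cast; linarith) hd) hB
      exact ⟨π', e1, fun u hu => ⟨(e2 u hu).1, (e2 u hu).2.1, (e2 u hu).2.2.mono (by omega) le_rfl⟩⟩

open scoped Classical in
lemma absorb_k {Tr : SimpleGraph (Fin k)} (hT : Tr.IsTree) {G : SimpleGraph (Fin n)} {a0 : Fin k}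
    {J : Finset (Fin k → Fin n)} (hJ : Fam Tr G J) (x : ℝ) (hI : IndepBound G 2 x)
    (r d : ℕ) (Y : Finset (Fin k → Fin n)) (hY : Y ⊆ J)
    (D : Finset (Fin k → Fin n)) (hD : D.card ≤ d)
    (hYc : k * x + d < Y.card)
    (e : Fin k → Fin n) (he : Function.Injective e) (heA : ∀ i, e i ∉ A J)
    (hp : ∀ i, Pool Tr G a0 J r (d + k * r + k) (e i) Y) :
    ∃ I ⊆ J, Disjoint I D ∧ I.card ≤ k * r ∧ PerfTilingOn Tr G (Finset.univ.image e ∪ A I) := by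
  have hinj : ∀ f ∈ J, ∀ g ∈ J, f a0 = g a0 → f = g := by
    intro f hf g hg h
    by_contra hne
    exact Finset.disjoint_left.1 (hJ.2 f hf g hg hne) (mem_im f a0) (h ▸ mem_im g a0)
  have hcS : ((Y \ D).image (fun y => y a0)).card = (Y \ D).card := by
    apply Finset.card_image_of_injOn
    intro f hf g hg h
    exact hinj f (hY (Finset.mem_sdiff.1 hf).1) g (hY (Finset.mem_sdiff.1 hg).1) h
  have hYD : (Y.card : ℝ) ≤ (Y \ D).card + D.card := by
    exact_mod_cast Finset.card_le_card_sdiff_add_card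
  have hDR : (D.card : ℝ) ≤ d := by exact_mod_cast hD
  obtain ⟨f, hf, hfS⟩ := find_emb Tr hT G x hI ((Y \ D).image (fun y => y a0)) (by
    rw [hcS]; linarith)
  have hy : ∀ i, ∃ y ∈ Y \ D, y a0 = f i := by
    intro i
    have := hfS (mem_im f i)
    simpa using this
  choose y hyY hyf using hy
  have hyY' : ∀ i, y i ∈ Y := fun i => (Finset.mem_sdiff.1 (hyY i)).1
  have hyD : ∀ i, y i ∉ D := fun i => (Finset.mem_sdiff.1 (hyY i)).2
  have hyinj : Function.Injective y := by
    intro i j h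
    apply hf.1
    rw [← hyf, ← hyf, h]
  have key : ∀ s : Finset (Fin k), ∃ I ⊆ J, Disjoint I D ∧ (∀ i, i ∉ s → y i ∉ I) ∧
      I.card ≤ s.card * r ∧ (∀ i ∈ s, y i ∈ I) ∧
      PerfTilingOn Tr G (s.image e ∪ (A I \ s.image f)) := by
    intro s
    induction s using Finset.induction_on with
    | empty => exact ⟨∅, by simp, by simp, by simp, by simp, by simp, by simpa [A] using perf_empty⟩
    | insert i s hi ih =>
      obtain ⟨I, h1, h2, h3, h4, h5, h6⟩ := ih
      have hsk : s.card ≤ k := by simpa using Finset.card_le_univ s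
      have hIk : I.card ≤ k * r := h4.trans (Nat.mul_le_mul_right _ hsk)
      have hyk : (Finset.univ.image y).card ≤ k := by
        simpa using Finset.card_image_le (s := (Finset.univ : Finset (Fin k))) (f := y)
      obtain ⟨I', g1, g2, g3, g4, g5⟩ := hp i (y i) (hyY' i)
        ((D ∪ I) ∪ (Finset.univ.image y).erase (y i)) (by
          have := Finset.card_union_le (D ∪ I) ((Finset.univ.image y).erase (y i))
          have := Finset.card_union_le D I
          have := Finset.card_erase_le (s := Finset.univ.image y) (a := y i)
          omega) (by
          simp only [Finset.mem_union, Finset.mem_erase, not_or]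
          exact ⟨⟨hyD i, h3 i hi⟩, fun h => h.1 rfl⟩)
      rw [Finset.disjoint_union_right, Finset.disjoint_union_right] at g3
      have hII : Disjoint (A I) (A I') := A_disj hJ h1 g1 g3.1.2.symm
      rw [Finset.disjoint_left] at hII
      have hfi : f i ∈ A I' := by rw [← hyf]; exact mem_A g2 a0
      have hfs : ∀ j ∈ s, f j ∈ A I := fun j hj => by rw [← hyf]; exact mem_A (h5 j hj) a0
      have heI : ∀ j, e j ∉ A I := fun j h => heA j (A_mono h1 h)
      have heI' : ∀ j, e j ∉ A I' := fun j h => heA j (A_mono g1 h)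
      refine ⟨I ∪ I', Finset.union_subset h1 g1, ?_, ?_, ?_, ?_, ?_⟩
      · rw [Finset.disjoint_union_left]; exact ⟨h2, g3.1.1⟩
      · intro j hj
        rw [Finset.mem_insert, not_or] at hj
        rw [Finset.mem_union, not_or]
        refine ⟨h3 j hj.2, fun h => Finset.disjoint_left.1 g3.2 h ?_⟩
        rw [Finset.mem_erase]
        exact ⟨fun h => hj.1 (hyinj h), by simp⟩
      · rw [Finset.card_insert_of_notMem hi, add_mul, one_mul]
        exact (Finset.card_union_le _ _).trans (by omega)
      · intro j hj
        rcases Finset.mem_insert.1 hj with rfl | hj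
        · exact Finset.mem_union_right _ g2
        · exact Finset.mem_union_left _ (h5 j hj)
      · rw [hyf] at g5
        have := perf_union h6 g5 (by
          rw [Finset.disjoint_left]
          intro z
          simp only [Finset.mem_union, Finset.mem_image, Finset.mem_sdiff, Finset.mem_insert,
            Finset.mem_erase]
          rintro (⟨j, hj, rfl⟩ | ⟨hz, -⟩)
          · rintro (h | h)
            · exact hi (he h ▸ hj)
            · exact heI' j h.2
          · rintro (rfl | h)
            · exact heI i hz
            · exact hII hz h.2)
        convert this using 1
        rw [A_union]
        ext z
        simp only [Finset.mem_union, Finset.mem_image, Finset.mem_sdiff, Finset.mem_insert,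
            Finset.mem_erase]
        constructor
        · rintro (⟨j, rfl | hj, rfl⟩ | ⟨hz | hz, hz'⟩)
          · tauto
          · exact Or.inl (Or.inl ⟨j, hj, rfl⟩)
          · refine Or.inl (Or.inr ⟨hz, ?_⟩)
            rintro ⟨j, hj, rfl⟩
            exact hz' ⟨j, Or.inr hj, rfl⟩
          · refine Or.inr (Or.inr ⟨?_, hz⟩)
            rintro rfl
            exact hz' ⟨i, Or.inl rfl, rfl⟩
        · rintro ((⟨j, hj, rfl⟩ | ⟨hz, hz'⟩) | (rfl | ⟨hz', hz⟩))
          · exact Or.inl ⟨j, Or.inr hj, rfl⟩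
          · refine Or.inr ⟨Or.inl hz, ?_⟩
            rintro ⟨j, rfl | hj, rfl⟩
            · exact hII hz hfi
            · exact hz' ⟨j, hj, rfl⟩
          · exact Or.inl ⟨i, Or.inl rfl, rfl⟩
          · refine Or.inr ⟨Or.inr hz, ?_⟩
            rintro ⟨j, rfl | hj, rfl⟩
            · exact hz' rfl
            · exact hII (hfs j hj) hz
  obtain ⟨I, h1, h2, h3, h4, h5, h6⟩ := key Finset.univ
  refine ⟨I, h1, h2, by simpa using h4, ?_⟩
  have hfI : im f ⊆ A I := by
    intro z hz
    simp only [im, Finset.mem_image, Finset.mem_univ, true_and] at hz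
    obtain ⟨j, rfl⟩ := hz
    rw [← hyf]; exact mem_A (h5 j (by simp)) a0
  have := perf_union h6 (perf_single (emb_spans hf)) (by
    rw [Finset.disjoint_left]
    intro z
    simp only [Finset.mem_union, Finset.mem_sdiff]
    rintro (hz | hz) hz'
    · obtain ⟨j, -, rfl⟩ := Finset.mem_image.1 hz
      exact heA j (A_mono h1 (hfI hz'))
    · exact hz.2 hz')
  convert this using 1
  rw [Finset.union_assoc]
  congr 1
  exact (Finset.sdiff_union_of_subset hfI).symm

open scoped Classical in
lemma absorb_one (hk : 0 < k) {Tr : SimpleGraph (Fin k)} (hT : Tr.IsTree)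
    {G : SimpleGraph (Fin n)} {a0 b0 : Fin k}
    (hab : ∀ b, Tr.Adj a0 b → b = b0) (x : ℝ) (hI : IndepBound G 2 x)
    {J : Finset (Fin k → Fin n)} (hJ : Fam Tr G J) (hne : J.Nonempty) (a θ : ℝ) (c m0 d : ℕ)
    (hdeg : ∀ y ∈ J, a * J.card ≤ (dg G b0 J (y a0) : ℝ))
    (ha : 1 + θ ≤ (c + 1) * a) (hθ : 0 < θ) (hm0 : m0 = c * (k - 1) + 1)
    (hza : θ / (4 * m0 ^ 3) ≤ a)
    (hd1 : ((d + k * (1 + m0) + k + m0 + 2 : ℕ) : ℝ) ≤ θ / (4 * m0) * (θ / (4 * m0 ^ 3) * J.card))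
    (hd2 : k * x + d < θ / (4 * m0 ^ 3) * J.card)
    (U : Finset (Fin n)) (hU : U.card = m0) (hUA : ∀ u ∈ U, u ∉ A J)
    (hUg : ∀ u ∈ U, a * J.card ≤ (dg G b0 J u : ℝ))
    (D : Finset (Fin k → Fin n)) (hD : D.card ≤ d) :
    ∃ U' ⊆ U, U'.card = k ∧ ∃ I ⊆ J, Disjoint I D ∧ I.card ≤ k * (1 + m0) ∧
      PerfTilingOn Tr G (U' ∪ A I) := by
  obtain ⟨π, h1, h2⟩ := merge_all hab hJ hne a θ c m0 hdeg ha hθ (by omega) U hU.le hUA m0 1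
    (d + k * (1 + m0) + k) (fun u => J.filter (fun f => G.Adj u (f b0)))
    (Finset.card_image_le.trans (by omega)) hd1 (by
      intro u hu
      refine ⟨Finset.filter_subset _ _, ?_, ?_⟩
      · have := hUg u hu
        have h3 : θ / (4 * m0 ^ 3) * J.card ≤ a * J.card := by gcongr
        exact h3.trans (by simpa [dg] using this)
      · exact pool_init hab hJ _ u (hUA u hu) _ (Finset.filter_subset _ _)
          (fun y hy => (Finset.mem_filter.1 hy).2))
  obtain ⟨Y, hY, hYc⟩ := Finset.exists_lt_card_fiber_of_mul_lt_card_of_maps_to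
    (s := U) (t := U.image π) (f := π) (n := k - 1) (fun u hu => Finset.mem_image_of_mem _ hu) (by
      have := Nat.mul_le_mul_right (k - 1) h1
      omega)
  obtain ⟨U', hU', hUc⟩ := Finset.exists_subset_card_eq (show k ≤ (U.filter (fun u => π u = Y)).card by omega)
  have hU'U : ∀ u ∈ U', u ∈ U ∧ π u = Y := fun u hu => Finset.mem_filter.1 (hU' hu)
  obtain ⟨u0, hu0, hu0Y⟩ := Finset.mem_image.1 hY
  have h3 := h2 u0 hu0
  rw [hu0Y] at h3
  set e := U'.orderEmbOfFin hUc with he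
  have heU : ∀ i, e i ∈ U' := fun i => Finset.orderEmbOfFin_mem _ _ _
  obtain ⟨I, i1, i2, i3, i4⟩ := absorb_k hT hJ x hI (1 + m0) d Y h3.1 D hD
    (lt_of_lt_of_le hd2 h3.2.1) e e.injective (fun i => hUA _ (hU'U _ (heU i)).1) (fun i => by
      have := h2 _ (hU'U _ (heU i)).1
      rw [(hU'U _ (heU i)).2] at this
      exact this.2.2)
  refine ⟨U', fun u hu => (hU'U u hu).1, hUc, I, i1, i2, i3, ?_⟩
  convert i4 using 2
  rw [he, Finset.image_orderEmbOfFin_univ]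

open scoped Classical in
lemma absorb_all (hk : 0 < k) {Tr : SimpleGraph (Fin k)} (hT : Tr.IsTree)
    {G : SimpleGraph (Fin n)} {a0 b0 : Fin k}
    (hab : ∀ b, Tr.Adj a0 b → b = b0) (x : ℝ) (hI : IndepBound G 2 x)
    {J : Finset (Fin k → Fin n)} (hJ : Fam Tr G J) (hne : J.Nonempty) (a θ : ℝ) (c m0 d : ℕ)
    (hdeg : ∀ y ∈ J, a * J.card ≤ (dg G b0 J (y a0) : ℝ))
    (ha : 1 + θ ≤ (c + 1) * a) (hθ : 0 < θ) (hm0 : m0 = c * (k - 1) + 1)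
    (hza : θ / (4 * m0 ^ 3) ≤ a)
    (hd1 : ((d + k * (1 + m0) + k + m0 + 2 : ℕ) : ℝ) ≤ θ / (4 * m0) * (θ / (4 * m0 ^ 3) * J.card))
    (hd2 : k * x + d < θ / (4 * m0 ^ 3) * J.card) :
    ∀ (L : Finset (Fin n)) (D : Finset (Fin k → Fin n)), (∀ u ∈ L, u ∉ A J) →
      (∀ u ∈ L, a * J.card ≤ (dg G b0 J u : ℝ)) →
      D.card + k * (1 + m0) * L.card ≤ d →
      ∃ L' ⊆ L, L'.card ≤ c * (k - 1) ∧ PerfTilingOn Tr G ((L \ L') ∪ A (J \ D)) := by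
  intro L
  induction L using Finset.strongInduction with
  | H L ih =>
    intro D hLA hLg hc
    by_cases hL : L.card ≤ c * (k - 1)
    · exact ⟨L, Finset.Subset.refl _, hL, by simpa using perf_A hJ Finset.sdiff_subset⟩
    · push Not at hL
      obtain ⟨U, hUL, hU⟩ := Finset.exists_subset_card_eq (show m0 ≤ L.card by omega)
      obtain ⟨U', hU', hUc, I, i1, i2, i3, i4⟩ := absorb_one hk hT hab x hI hJ hne a θ c m0 d hdeg
        ha hθ hm0 hza hd1 hd2 U hU (fun u hu => hLA u (hUL hu)) (fun u hu => hLg u (hUL hu)) D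
        (by omega)
      have hU'L : U' ⊆ L := hU'.trans hUL
      have hU'ne : U'.Nonempty := Finset.card_pos.1 (by omega)
      have hcard : (L \ U').card + k = L.card := by
        rw [← hUc]; exact Finset.card_sdiff_add_card_eq_card hU'L
      obtain ⟨L', l1, l2, l3⟩ := ih (L \ U') (Finset.sdiff_ssubset hU'L hU'ne) (D ∪ I)
        (fun u hu => hLA u (Finset.mem_sdiff.1 hu).1) (fun u hu => hLg u (Finset.mem_sdiff.1 hu).1) (by
          have h1 := Finset.card_union_le D I
          have h2 : (L \ U').card + 1 ≤ L.card := by omega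
          have h3 := Nat.mul_le_mul_left (k * (1 + m0)) h2
          rw [mul_add, mul_one] at h3
          omega)
      refine ⟨L', l1.trans Finset.sdiff_subset, l2, ?_⟩
      have hdAI : Disjoint (A (J \ (D ∪ I))) (A I) := A_disj hJ Finset.sdiff_subset i1 (by
        rw [Finset.disjoint_left]
        intro f hf hf'
        exact (Finset.mem_sdiff.1 hf).2 (Finset.mem_union_right _ hf'))
      have := perf_union l3 i4 (by
        rw [Finset.disjoint_left] at hdAI ⊢
        intro z
        simp only [Finset.mem_union, Finset.mem_sdiff]
        rintro (⟨⟨z1, z2⟩, z3⟩ | z1) (z4 | z4)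
        · exact z2 z4
        · exact hLA z z1 (A_mono i1 z4)
        · exact hLA z (hU'L z4) (A_mono Finset.sdiff_subset z1)
        · exact hdAI z1 z4)
      convert this using 1
      have e1 : J \ D = (J \ (D ∪ I)) ∪ I := by
        ext f
        have := @i1 f
        have := fun h : f ∈ I => Finset.disjoint_left.1 i2 h
        simp only [Finset.mem_union, Finset.mem_sdiff]
        tauto
      rw [e1, A_union]
      ext z
      have q1 := @hU'L z
      have q2 := @l1 z
      simp only [Finset.mem_union, Finset.mem_sdiff] at q2 ⊢
      tauto

end absorb

end RTT

namespace RTT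

section final

variable {k n : ℕ}

open scoped Classical in
lemma cover_bad (hk : 0 < k) {Tr : SimpleGraph (Fin k)} (hT : Tr.IsTree)
    {G : SimpleGraph (Fin n)} {a0 b0 : Fin k} (hab : ∀ b, Tr.Adj a0 b → b = b0)
    (hb : b0 ≠ a0) (x η : ℝ) (hG : MinDegGE G (η * n)) (hI : IndepBound G 2 x)
    (P : Finset (Fin n)) : ∀ B : Finset (Fin n), k * x + P.card + k * B.card < η * n →
    ∃ A1, PerfTilingOn Tr G A1 ∧ Disjoint A1 P ∧ (∀ u ∈ B, u ∈ A1 ∨ u ∈ P) ∧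
      A1.card ≤ k * B.card := by
  intro B
  induction B using Finset.induction_on with
  | empty => intro _; exact ⟨∅, perf_empty, by simp, by simp, by simp⟩
  | insert u B hu ih =>
    intro hc
    rw [Finset.card_insert_of_notMem hu] at hc ⊢
    push_cast at hc
    have hkp : (0:ℝ) < k := by exact_mod_cast hk
    obtain ⟨A1, h1, h2, h3, h4⟩ := ih (by nlinarith)
    by_cases huc : u ∈ A1 ∨ u ∈ P
    · refine ⟨A1, h1, h2, ?_, h4.trans (Nat.mul_le_mul_left _ (by omega))⟩
      intro v hv
      rcases Finset.mem_insert.1 hv with rfl | hv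
      · exact huc
      · exact h3 v hv
    · rw [not_or] at huc
      set N := Finset.univ.filter (fun v => G.Adj u v) with hN
      have hNc : η * n ≤ (N.card : ℝ) := by
        have := hG u
        rwa [show G.neighborSet u = (N : Set (Fin n)) by ext v; simp [hN], Set.ncard_coe_finset] at this
      have hS : k * x < ((N \ (A1 ∪ P)).card : ℝ) := by
        have q1 : N.card ≤ (N \ (A1 ∪ P)).card + (A1 ∪ P).card := Finset.card_le_card_sdiff_add_card
        have q2 := Finset.card_union_le A1 P
        have q3 : (N.card : ℝ) ≤ (N \ (A1 ∪ P)).card + (k * B.card + P.card) := by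
          exact_mod_cast q1.trans (by omega)
        linarith
      obtain ⟨f, hf, hfS⟩ := find_emb Tr hT G x hI _ hS
      have hfN : ∀ v ∈ im f, G.Adj u v ∧ v ∉ A1 ∧ v ∉ P := by
        intro v hv
        have := hfS hv
        simpa [hN] using this
      have hadj := (hfN _ (mem_im f b0)).1
      have huf : u ∉ im f := fun h => G.loopless.irrefl u (hfN u h).1
      have hsp := swap_spans hf a0 b0 hab u (fun h => huf (Finset.mem_of_mem_erase h)) hadj
      have hdis : ∀ v ∈ insert u ((im f).erase (f a0)), v ∉ A1 ∧ v ∉ P := by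
        intro v hv
        rcases Finset.mem_insert.1 hv with rfl | hv
        · exact huc
        · exact (hfN v (Finset.mem_of_mem_erase hv)).2
      refine ⟨A1 ∪ insert u ((im f).erase (f a0)), perf_union h1 (perf_single hsp) ?_, ?_, ?_, ?_⟩
      · rw [Finset.disjoint_right]; exact fun v hv => (hdis v hv).1
      · rw [Finset.disjoint_union_left]
        refine ⟨h2, ?_⟩
        rw [Finset.disjoint_left]; exact fun v hv => (hdis v hv).2
      · intro v hv
        rcases Finset.mem_insert.1 hv with rfl | hv
        · left; simp
        · rcases h3 v hv with h | h
          · left; exact Finset.mem_union_left _ h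
          · right; exact h
      · have q1 := Finset.card_union_le A1 (insert u ((im f).erase (f a0)))
        have q2 := Finset.card_insert_le u ((im f).erase (f a0))
        rw [Finset.card_erase_of_mem (mem_im f a0), card_im hf] at q2
        rw [mul_add, mul_one]
        omega

open scoped Classical in
lemma core (hk : 3 ≤ k) {Tr : SimpleGraph (Fin k)} (hT : Tr.IsTree)
    {G : SimpleGraph (Fin n)} (η ε θ x β : ℝ) (c m0 M : ℕ) (hε : 0 < ε) (hεη : ε ≤ η) (hη : η ≤ 1)
    (hε2 : ε ≤ 1 / 2) (hθ : 0 < θ) (hG : MinDegGE G (η * n)) (hI : IndepBound G 2 x)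
    (hM0 : 0 < M) (hM : k * x + k * M < ε * n) (hβ : n ≤ β * (ε ^ 2 * M)) (hβ2 : β ≤ ε * M)
    (hgr : k * x + k * M + k * β < η * n)
    (ha : 1 + θ ≤ (c + 1) * (η - 3 * ε)) (hm0 : m0 = c * (k - 1) + 1)
    (hza : θ / (4 * m0 ^ 3) ≤ η - 3 * ε)
    (hd1 : k * (1 + m0) * (k * x) + (k * (1 + m0) + k + m0 + 2) ≤
      θ / (4 * m0) * (θ / (4 * m0 ^ 3) * (M / 2)))
    (hd2 : k * x + k * (1 + m0) * (k * x) < θ / (4 * m0 ^ 3) * (M / 2)) :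
    ∃ T : Finset (Finset (Fin n)), IsTiling Tr G T ∧
            (Finset.univ \ T.biUnion id).card ≤ c * (k - 1) := by
  have hk0 : 0 < k := by omega
  have hkR : (0:ℝ) < k := by exact_mod_cast hk0
  have hMR : (0:ℝ) < M := by exact_mod_cast hM0
  have hm0R : (0:ℝ) < m0 := by rw [hm0]; positivity
  haveI : Nontrivial (Fin k) := Fin.nontrivial_iff_two_le.2 (by omega)
  obtain ⟨a0, ha0⟩ := hT.exists_vert_degree_one_of_nontrivial
  obtain ⟨b0, hb0, hab⟩ := SimpleGraph.degree_eq_one_iff_existsUnique_adj.1 ha0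
  have hb : b0 ≠ a0 := fun h => Tr.loopless.irrefl a0 (h ▸ hb0)
  obtain ⟨J0, hJ0, hJ0c, hP⟩ := exists_fam Tr hT G b0 η ε x hε hεη hη hG hI M hM M le_rfl
  have hbc := bad_card G b0 η ε hε M hM0 J0 hP
  set Bad := Finset.univ.filter (fun u => (dg G b0 J0 u : ℝ) < (η - 2 * ε) * M) with hBad
  have hBβ : (Bad.card : ℝ) ≤ β := by
    have : (0:ℝ) < ε ^ 2 * M := by positivity
    exact le_of_mul_le_mul_right (hbc.trans hβ) this
  set J := J0.filter (fun f => f a0 ∉ Bad) with hJd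
  have hJJ : J ⊆ J0 := Finset.filter_subset _ _
  have hJ : Fam Tr G J := ⟨fun f hf => hJ0.1 f (hJJ hf), fun f hf g hg => hJ0.2 f (hJJ hf) g (hJJ hg)⟩
  have hinj : ∀ f ∈ J0, ∀ g ∈ J0, f a0 = g a0 → f = g := by
    intro f hf g hg h
    by_contra hne
    exact Finset.disjoint_left.1 (hJ0.2 f hf g hg hne) (mem_im f a0) (h ▸ mem_im g a0)
  have hdiff : (J0 \ J).card ≤ Bad.card := by
    apply Finset.card_le_card_of_injOn (fun f => f a0)
    · intro f hf
      have := Finset.mem_sdiff.1 hf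
      by_contra hh
      exact this.2 (Finset.mem_filter.2 ⟨this.1, hh⟩)
    · intro f hf g hg h
      exact hinj f (Finset.mem_sdiff.1 hf).1 g (Finset.mem_sdiff.1 hg).1 h
  have hJlow : (M : ℝ) / 2 ≤ J.card := by
    have h1 : J0.card ≤ (J0 \ J).card + J.card := Finset.card_le_card_sdiff_add_card
    have h2 : (M : ℝ) ≤ Bad.card + J.card := by exact_mod_cast (by omega : M ≤ Bad.card + J.card)
    nlinarith
  have hJup : (J.card : ℝ) ≤ M := by
    exact_mod_cast (Finset.card_le_card hJJ).trans hJ0c.le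
  have hJp : (0:ℝ) < J.card := by linarith [half_pos hMR]
  have hne : J.Nonempty := Finset.card_pos.1 (by exact_mod_cast hJp)
  have hapos : 0 ≤ η - 3 * ε := le_trans (by positivity) hza
  have hgood : ∀ u, u ∉ Bad → (η - 3 * ε) * J.card ≤ (dg G b0 J u : ℝ) := by
    intro u hu
    have h1 : (η - 2 * ε) * M ≤ (dg G b0 J0 u : ℝ) := by
      by_contra h
      push Not at h
      exact hu (Finset.mem_filter.2 ⟨by simp, h⟩)
    have h2 : dg G b0 J0 u ≤ dg G b0 J u + (J0 \ J).card := by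
      unfold dg
      refine le_trans (Finset.card_le_card ?_) (Finset.card_union_le _ _)
      intro f hf
      have := Finset.mem_filter.1 hf
      by_cases hfJ : f ∈ J
      · exact Finset.mem_union_left _ (Finset.mem_filter.2 ⟨hfJ, this.2⟩)
      · exact Finset.mem_union_right _ (Finset.mem_sdiff.2 ⟨this.1, hfJ⟩)
    have h3 : (dg G b0 J0 u : ℝ) ≤ dg G b0 J u + Bad.card := by
      exact_mod_cast h2.trans (by omega)
    have h4 : (η - 3 * ε) * J.card ≤ (η - 3 * ε) * M := by gcongr
    linarith
  have hAJ : (A J).card ≤ k * M := by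
    have h1 : (A J).card ≤ J.card * k := Finset.card_biUnion_le_card_mul _ _ _
      (fun f hf => (card_im (hJ.1 f hf)).le)
    have h2 : J.card ≤ M := by exact_mod_cast hJup
    calc _ ≤ J.card * k := h1
      _ ≤ M * k := Nat.mul_le_mul_right _ h2
      _ = k * M := mul_comm _ _
  have hAJR : ((A J).card : ℝ) ≤ k * M := by exact_mod_cast hAJ
  obtain ⟨A1, p1, p2, p3, -⟩ := cover_bad hk0 hT hab hb x η hG hI (A J) Bad (by
    have : (k:ℝ) * Bad.card ≤ k * β := by gcongr
    linarith)
  obtain ⟨A2, hA2, hmax⟩ := Finset.exists_max_image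
    (Finset.univ.filter (fun S : Finset (Fin n) => A1 ⊆ S ∧ PerfTilingOn Tr G S ∧ Disjoint S (A J)))
    Finset.card ⟨A1, by simp [p1, p2]⟩
  simp only [Finset.mem_filter, Finset.mem_univ, true_and] at hA2 hmax
  obtain ⟨q1, q2, q3⟩ := hA2
  set L := Finset.univ \ (A2 ∪ A J) with hL
  have hLm : ∀ u ∈ L, u ∉ A2 ∧ u ∉ A J := by
    intro u hu
    simpa [hL] using hu
  have hLc : (L.card : ℝ) ≤ k * x := by
    by_contra h
    push Not at h
    obtain ⟨f, hf, hfL⟩ := find_emb Tr hT G x hI L h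
    have d1 : Disjoint A2 (im f) := by
      rw [Finset.disjoint_right]; exact fun v hv => (hLm v (hfL hv)).1
    have d2 : Disjoint (im f) (A J) := by
      rw [Finset.disjoint_left]; exact fun v hv => (hLm v (hfL hv)).2
    have := hmax (A2 ∪ im f) ⟨q1.trans Finset.subset_union_left,
      perf_union q2 (perf_single (emb_spans hf)) d1, Finset.disjoint_union_left.2 ⟨q3, d2⟩⟩
    rw [Finset.card_union_of_disjoint d1, card_im hf] at this
    omega
  have hLg : ∀ u ∈ L, (η - 3 * ε) * J.card ≤ (dg G b0 J u : ℝ) := by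
    intro u hu
    apply hgood
    intro hB
    rcases p3 u hB with h | h
    · exact (hLm u hu).1 (q1 h)
    · exact (hLm u hu).2 h
  have hLk : (k:ℝ) * (1 + m0) * L.card ≤ k * (1 + m0) * (k * x) := by gcongr
  have hζ : θ / (4 * m0 ^ 3) * (M / 2) ≤ θ / (4 * m0 ^ 3) * J.card := by gcongr
  obtain ⟨L', l1, l2, l3⟩ := absorb_all hk0 hT hab x hI hJ hne (η - 3 * ε) θ c m0
    (k * (1 + m0) * L.card) (fun y hy => hgood _ (Finset.mem_filter.1 hy).2) ha hθ hm0 hza (by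
      push_cast
      have : θ / (4 * m0) * (θ / (4 * m0 ^ 3) * (M / 2)) ≤ θ / (4 * m0) * (θ / (4 * m0 ^ 3) * J.card) := by
        gcongr
      linarith) (by push_cast; linarith) L ∅ (fun u hu => (hLm u hu).2) hLg (by simp)
  rw [Finset.sdiff_empty] at l3
  obtain ⟨T, hT1, hT2⟩ := perf_union q2 l3 (by
    rw [Finset.disjoint_union_right]
    refine ⟨?_, q3⟩
    rw [Finset.disjoint_right]
    exact fun u hu => (hLm u (Finset.mem_sdiff.1 hu).1).1)
  refine ⟨T, hT1, le_trans (Finset.card_le_card ?_) l2⟩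
  rw [hT2]
  intro u hu
  simp only [hL, Finset.mem_sdiff, Finset.mem_union, Finset.mem_univ, true_and] at hu
  tauto

end final

end RTT

set_option maxHeartbeats 2000000 in
open RTT in
theorem quasi_aux :
    ∀ k : ℕ, 3 ≤ k → ∀ η : ℝ, 0 < η → η ≤ 1 →
    ∃ α : ℝ, 0 < α ∧ ∃ N : ℕ, ∀ n : ℕ, N ≤ n →
      ∀ G : SimpleGraph (Fin n),
        MinDegGE G (η * n) → IndepBound G 2 (α * n) →
        ∀ Tr : SimpleGraph (Fin k), Tr.IsTree →
          ∃ T : Finset (Finset (Fin n)),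
            IsTiling Tr G T ∧
            (Finset.univ \ T.biUnion id).card ≤ ⌊1 / η⌋₊ * (k - 1) := by
  intro k hk η hη hη1
  set c := ⌊1 / η⌋₊ with hc
  have hcl : 1 < ((c:ℝ) + 1) * η := by
    have := Nat.lt_floor_add_one (1 / η)
    rwa [div_lt_iff₀ hη] at this
  have hcu : (c:ℝ) * η ≤ 1 := by
    have := Nat.floor_le (a := 1 / η) (by positivity)
    rwa [le_div_iff₀ hη] at this
  have hkR : (3:ℝ) ≤ k := by exact_mod_cast hk
  have hc0 : (0:ℝ) ≤ c := by positivity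
  obtain ⟨θ, hθd⟩ : ∃ θ : ℝ, θ = (((c:ℝ) + 1) * η - 1) / 2 := ⟨_, rfl⟩
  have hθ : 0 < θ := by rw [hθd]; linarith
  have hθ2 : θ ≤ 1 / 2 := by rw [hθd]; linarith
  obtain ⟨ε, hεd⟩ : ∃ ε : ℝ, ε = θ / (3 * ((c:ℝ) + 1)) := ⟨_, rfl⟩
  have hε : 0 < ε := by rw [hεd]; positivity
  have hεm : 3 * ε * ((c:ℝ) + 1) = θ := by rw [hεd]; field_simp
  have ha : 1 + θ = (c + 1) * (η - 3 * ε) := by linarith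
  have hε6 : ε ≤ 1 / 6 := by nlinarith
  have hεη : ε ≤ η := by
    by_contra h
    push Not at h
    nlinarith
  obtain ⟨m0, hm0⟩ : ∃ m0 : ℕ, m0 = c * (k - 1) + 1 := ⟨_, rfl⟩
  have hm0c : c + 1 ≤ m0 := by
    rw [hm0]
    have : c * 1 ≤ c * (k - 1) := Nat.mul_le_mul_left _ (by omega)
    omega
  have hm0cR : (c:ℝ) + 1 ≤ m0 := by exact_mod_cast hm0c
  have hm1 : (1:ℝ) ≤ m0 := by linarith
  have hm3 : (m0:ℝ) ≤ (m0:ℝ) ^ 3 := le_self_pow₀ hm1 (by norm_num)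
  obtain ⟨ζ, hζd⟩ : ∃ ζ : ℝ, ζ = θ / (4 * (m0:ℝ) ^ 3) := ⟨_, rfl⟩
  obtain ⟨κ, hκd⟩ : ∃ κ : ℝ, κ = θ / (4 * (m0:ℝ)) := ⟨_, rfl⟩
  have hζ : 0 < ζ := by rw [hζd]; positivity
  have hκ : 0 < κ := by rw [hκd]; positivity
  have hκ1 : κ ≤ 1 / 8 := by
    rw [hκd, div_le_iff₀ (by positivity)]; linarith
  have hza : ζ ≤ η - 3 * ε := by
    rw [hζd, div_le_iff₀ (by positivity)]
    have h1 : 0 ≤ η - 3 * ε := by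
      by_contra h
      push Not at h
      nlinarith
    have : (η - 3 * ε) * (c + 1) ≤ (η - 3 * ε) * (4 * (m0:ℝ) ^ 3) := by
      apply mul_le_mul_of_nonneg_left _ h1
      linarith
    linarith
  obtain ⟨ρ, hρd⟩ : ∃ ρ : ℝ, ρ = ε / (4 * k) := ⟨_, rfl⟩
  have hρ : 0 < ρ := by rw [hρd]; positivity
  have hkρ : k * ρ = ε / 4 := by rw [hρd]; field_simp
  obtain ⟨β, hβd⟩ : ∃ β : ℝ, β = 2 / (ε ^ 2 * ρ) := ⟨_, rfl⟩
  have hβ : 0 < β := by rw [hβd]; positivity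
  have hβm : β * ε ^ 2 * ρ = 2 := by rw [hβd]; field_simp
  obtain ⟨K, hKd⟩ : ∃ K : ℝ, K = k * (1 + m0) * k := ⟨_, rfl⟩
  have hK : k ≤ K := by
    rw [hKd]
    have : (1:ℝ) ≤ (1 + m0) * k := by nlinarith
    nlinarith
  have hK0 : 0 < K := by linarith
  obtain ⟨C, hCd⟩ : ∃ C : ℝ, C = k * (1 + m0) + k + m0 + 2 := ⟨_, rfl⟩
  obtain ⟨σ, hσd⟩ : ∃ σ : ℝ, σ = κ * ζ * ρ := ⟨_, rfl⟩
  have hσ : 0 < σ := by rw [hσd]; positivity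
  have hσζ : σ ≤ ζ * ρ / 8 := by
    have := mul_le_mul_of_nonneg_right hκ1 (mul_pos hζ hρ).le
    rw [hσd]; linarith
  refine ⟨min (ε / (4 * k)) (σ / (8 * K)), by positivity, ⌈2 / ρ⌉₊ + ⌈2 * β / (ε * ρ)⌉₊ + ⌈8 * C / σ⌉₊ + 1, ?_⟩
  intro n hn G hG hI Tr hT
  obtain ⟨α, hαd⟩ : ∃ α : ℝ, α = min (ε / (4 * k)) (σ / (8 * K)) := ⟨_, rfl⟩
  rw [← hαd] at hI
  have hα0 : 0 < α := by rw [hαd]; positivity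
  have hα1 : k * α ≤ ε / 4 := by
    have : α ≤ ε / (4 * k) := hαd ▸ min_le_left _ _
    rw [le_div_iff₀ (by positivity)] at this
    linarith
  have hα2 : K * α ≤ σ / 8 := by
    have : α ≤ σ / (8 * K) := hαd ▸ min_le_right _ _
    rw [le_div_iff₀ (by positivity)] at this
    linarith
  have hn0 : (0:ℝ) < n := by exact_mod_cast (by omega : 0 < n)
  have hn1 : 2 ≤ ρ * n := by
    have : 2 / ρ ≤ n := (Nat.le_ceil _).trans (by exact_mod_cast (by omega : ⌈2 / ρ⌉₊ ≤ n))
    rw [div_le_iff₀ hρ] at this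
    linarith
  have hn2 : 2 * β ≤ ε * (ρ * n) := by
    have : 2 * β / (ε * ρ) ≤ n := (Nat.le_ceil _).trans
      (by exact_mod_cast (by omega : ⌈2 * β / (ε * ρ)⌉₊ ≤ n))
    rw [div_le_iff₀ (by positivity)] at this
    linarith
  have hn3 : 8 * C ≤ σ * n := by
    have : 8 * C / σ ≤ n := (Nat.le_ceil _).trans
      (by exact_mod_cast (by omega : ⌈8 * C / σ⌉₊ ≤ n))
    rw [div_le_iff₀ hσ] at this
    linarith
  obtain ⟨M, hMd⟩ : ∃ M : ℕ, M = ⌊ρ * n⌋₊ := ⟨_, rfl⟩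
  have hMu : (M:ℝ) ≤ ρ * n := by rw [hMd]; exact Nat.floor_le (by positivity)
  have hMl : ρ * n / 2 ≤ (M:ℝ) := by
    have := Nat.lt_floor_add_one (ρ * n)
    rw [← hMd] at this
    linarith
  have hM0 : 0 < M := by
    have : (0:ℝ) < M := by linarith
    exact_mod_cast this
  have hkM : k * (M:ℝ) ≤ ε / 4 * n := by
    rw [← hkρ, mul_assoc]
    gcongr
  have hkx : k * (α * n) ≤ ε / 4 * n := by
    rw [← mul_assoc]
    gcongr
  have hεn : 0 < ε * n := by positivity
  have hkβ : k * β ≤ ε / 4 * n := by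
    have h1 : k * (2 * β) ≤ k * (ε * (ρ * n)) := by gcongr
    have h2 : k * (ε * (ρ * n)) = ε * (k * ρ) * n := by ring
    rw [h2, hkρ] at h1
    nlinarith
  have hKx : K * (α * n) ≤ σ / 8 * n := by
    rw [← mul_assoc]
    gcongr
  have hζM : ζ * (ρ * n / 2 / 2) ≤ ζ * (M / 2) := by gcongr
  have hκM : κ * (ζ * (ρ * n / 2 / 2)) ≤ κ * (ζ * (M / 2)) := by gcongr
  have hσn : κ * (ζ * (ρ * n / 2 / 2)) = σ * n / 4 := by rw [hσd]; ring
  have hσn0 : 0 < σ * n := by positivity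
  have hKe : k * (1 + m0) * (k * (α * n)) = K * (α * n) := by rw [hKd]; ring
  have hxp : 0 ≤ α * n := by positivity
  have hkK : k * (α * n) ≤ K * (α * n) := by gcongr
  have hσζn : σ * n ≤ ζ * ρ / 8 * n := by gcongr
  exact core hk hT η ε θ (α * n) β c m0 M hε hεη hη1 (by linarith) hθ hG hI hM0 (by linarith)
    (by
      have h1 : β * (ε ^ 2 * (ρ * n / 2)) ≤ β * (ε ^ 2 * M) := by gcongr
      have h2 : β * (ε ^ 2 * (ρ * n / 2)) = β * ε ^ 2 * ρ * n / 2 := by ring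
      rw [h2, hβm] at h1
      linarith)
    (by
      have : ε * (ρ * n / 2) ≤ ε * M := by gcongr
      linarith)
    (by
      have : ε * n ≤ η * n := by gcongr
      linarith)
    ha.le hm0 (by rw [← hζd]; exact hza)
    (by rw [← hζd, ← hκd, hKe, ← hCd]; linarith)
    (by rw [← hζd, hKe]; linarith)

open RTT in
/-- For every integer `k ≥ 3` and constant `0 < η ≤ 1` there exists `α > 0`
such that for all sufficiently large `n`, every `n`-vertex graph `G` with `δ(G) ≥ ηn` and
`α(G) ≤ αn` contains, for every tree `T` on `k` vertices, a `T`-tiling covering all but at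
most `⌊1/η⌋(k-1)` vertices. -/
theorem quasiperfect_tree_tiling :
    ∀ k : ℕ, 3 ≤ k → ∀ η : ℝ, 0 < η → η ≤ 1 →
    ∃ α : ℝ, 0 < α ∧ ∃ N : ℕ, ∀ n : ℕ, N ≤ n →
      ∀ G : SimpleGraph (Fin n),
        MinDegGE G (η * n) → IndepBound G 2 (α * n) →
        ∀ Tr : SimpleGraph (Fin k), Tr.IsTree →
          ∃ T : Finset (Finset (Fin n)),
            IsTiling Tr G T ∧
            (Finset.univ \ T.biUnion id).card ≤ ⌊1 / η⌋₊ * (k - 1) := by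
  exact quasi_aux
end

section
/- For every integer k ≥ 3, every k-vertex graph F containing a cycle, every constant 0 < η < γ(F)/k and every α > 0, the following holds for all sufficiently large n ∈ ℕ, where μ := γ(F)/k − η > 0. There exists an n-vertex graph G with minimum degree δ(G) ≥ ηn and independence number α(G) ≤ αn such that every F-tiling in G covers at most (1−μ)n vertices. -/
open Finset

namespace RTT

/-- `γ(F)`: the minimum size of a vertex set `S` such that `F - S` is acyclic. -/
noncomputable def gammaAcyclic {k : ℕ} (F : SimpleGraph (Fin k)) : ℕ :=
  sInf {m | ∃ S : Finset (Fin k), S.card = m ∧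
    (F.induce ((S : Set (Fin k))ᶜ)).IsAcyclic}

end RTT

namespace RTTAux

open RTT

lemma count_fun {ι β : Type*} [Fintype ι] [DecidableEq ι] [Fintype β] [DecidableEq β]
    (C : Finset ι) (A : ι → Finset β) :
    (univ.filter (fun f : ι → β => ∀ c ∈ C, f c ∈ A c)).card * Fintype.card β ^ C.card
      = (∏ c ∈ C, (A c).card) * Fintype.card β ^ Fintype.card ι := by
  have h : univ.filter (fun f : ι → β => ∀ c ∈ C, f c ∈ A c)
      = Fintype.piFinset (fun c => if c ∈ C then A c else univ) := by
    ext f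
    simp only [mem_filter, mem_univ, true_and, Fintype.mem_piFinset]
    refine forall_congr' fun c => ?_
    split_ifs <;> simp_all
  rw [h, Fintype.card_piFinset]
  have h2 : (∏ i : ι, (if i ∈ C then A i else univ).card)
      = (∏ c ∈ C, (A c).card) * Fintype.card β ^ (Cᶜ).card := by
    rw [← Finset.prod_mul_prod_compl C]
    congr 1
    · exact Finset.prod_congr rfl fun x hx => by simp [hx]
    · rw [← Finset.card_univ, ← Finset.prod_const]
      refine Finset.prod_congr rfl fun x hx => ?_
      rw [if_neg (by simpa using hx)]
  rw [h2, mul_assoc, ← pow_add, add_comm, Finset.card_add_card_compl]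

/-- bad sets -/
def bad {n d : ℕ} (k : ℕ) (f : Fin n × Fin d → Fin n) : Finset (Finset (Fin n)) :=
  univ.filter fun U => U.card ≤ k ∧ U.card ≤ ((U ×ˢ univ).filter fun c => f c ∈ U).card

def ind {n d : ℕ} (s : ℕ) (f : Fin n × Fin d → Fin n) : Finset (Finset (Fin n)) :=
  univ.filter fun S => S.card = s ∧ ∀ c ∈ S ×ˢ univ, f c ∈ (S.erase c.1)ᶜ

lemma sum_bad (k n d : ℕ) (hn : 0 < n) :
    ∑ f : Fin n × Fin d → Fin n, (bad k f).card
      ≤ ((k+1) * (2 ^ (k*d) * (k+1)^k)) * Fintype.card (Fin n × Fin d → Fin n) := by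
  set M := Fintype.card (Fin n × Fin d → Fin n) with hM
  have hM' : M = n ^ Fintype.card (Fin n × Fin d) := by simp [hM]
  have key : ∀ U : Finset (Fin n), U.card ≤ k →
      (univ.filter fun f : Fin n × Fin d → Fin n =>
        U.card ≤ ((U ×ˢ univ).filter fun c => f c ∈ U).card).card * n ^ U.card
        ≤ 2 ^ (k*d) * (k+1)^k * M := by
    intro U hU
    have h1 : (univ.filter fun f : Fin n × Fin d → Fin n =>
        U.card ≤ ((U ×ˢ univ).filter fun c => f c ∈ U).card) ⊆
        (((U ×ˢ (univ : Finset (Fin d))).powersetCard U.card)).biUnion fun C =>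
          univ.filter (fun f : Fin n × Fin d → Fin n => ∀ c ∈ C, f c ∈ U) := by
      intro f hf
      simp only [mem_filter, mem_univ, true_and] at hf
      obtain ⟨C, hC, hCc⟩ := Finset.exists_subset_card_eq hf
      simp only [mem_biUnion, mem_powersetCard, mem_filter, mem_univ, true_and]
      exact ⟨C, ⟨hC.trans (filter_subset _ _), hCc⟩, fun c hc => (mem_filter.1 (hC hc)).2⟩
    have h2 := (card_le_card h1).trans card_biUnion_le
    calc _ ≤ (∑ C ∈ (U ×ˢ (univ : Finset (Fin d))).powersetCard U.card,
          (univ.filter (fun f : Fin n × Fin d → Fin n => ∀ c ∈ C, f c ∈ U)).card) * n ^ U.card :=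
          Nat.mul_le_mul_right _ h2
      _ = ∑ C ∈ (U ×ˢ (univ : Finset (Fin d))).powersetCard U.card, U.card ^ U.card * M := by
          rw [sum_mul]
          refine sum_congr rfl fun C hC => ?_
          have := count_fun C (fun _ => U)
          rw [mem_powersetCard] at hC
          simp only [prod_const, hC.2, Fintype.card_fin] at this
          rw [this, hM']
      _ = (U.card * d).choose U.card * (U.card ^ U.card * M) := by
          simp
      _ ≤ 2 ^ (k*d) * ((k+1)^k * M) := by
          gcongr
          · exact (Nat.choose_le_two_pow _ _).trans (Nat.pow_le_pow_right (by norm_num) (by gcongr))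
          · omega
          · omega
      _ = _ := by ring
  have e : ∑ f : Fin n × Fin d → Fin n, (bad k f).card
      = ∑ U ∈ univ.filter (fun U : Finset (Fin n) => U.card ≤ k),
      (univ.filter fun f : Fin n × Fin d → Fin n =>
        U.card ≤ ((U ×ˢ univ).filter fun c => f c ∈ U).card).card := by
    simp only [bad, card_filter, sum_filter]
    rw [sum_comm]
    refine sum_congr rfl fun U _ => ?_
    by_cases h : U.card ≤ k <;> simp [h]
  rw [e]
  rw [← Finset.sum_fiberwise_of_maps_to (t := range (k+1)) (g := Finset.card)
    (by intro U hU; simp at hU ⊢; omega)]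
  calc _ ≤ ∑ l ∈ range (k+1), 2 ^ (k*d) * (k+1)^k * M := by
        refine sum_le_sum fun l hl => ?_
        have hl : l ≤ k := by simp at hl; omega
        refine Nat.le_of_mul_le_mul_right (c := n ^ l) ?_ (by positivity)
        rw [sum_mul]
        calc _ ≤ ∑ U ∈ powersetCard l (univ : Finset (Fin n)), 2 ^ (k*d) * (k+1)^k * M := by
              refine (sum_le_sum (g := fun _ => 2 ^ (k*d) * (k+1)^k * M) fun U hU => ?_).trans
                (sum_le_sum_of_subset ?_)
              · simp only [mem_filter, mem_univ, true_and] at hU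
                have := key U hU.1
                have e2 : n ^ U.card = n ^ l := by rw [hU.2]
                rwa [e2] at this
              · intro U hU
                simp only [mem_filter, mem_univ, true_and] at hU
                simp [mem_powersetCard, hU.2]
          _ = n.choose l * (2 ^ (k*d) * (k+1)^k * M) := by simp
          _ ≤ n ^ l * (2 ^ (k*d) * (k+1)^k * M) := by
              gcongr; exact Nat.choose_le_pow _ _
          _ = _ := by ring
    _ = _ := by simp; ring

lemma sum_ind (n d s : ℕ) (hs : 1 ≤ s) (hsn : s ≤ n) :
    (∑ f : Fin n × Fin d → Fin n, (ind s f).card) * n ^ (s*d)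
      ≤ 2 ^ n * (n - (s - 1)) ^ (s*d) * Fintype.card (Fin n × Fin d → Fin n) := by
  set M := Fintype.card (Fin n × Fin d → Fin n) with hM
  have hM' : M = n ^ Fintype.card (Fin n × Fin d) := by simp [hM]
  have e : ∑ f : Fin n × Fin d → Fin n, (ind s f).card
      = ∑ S ∈ univ.filter (fun U : Finset (Fin n) => U.card = s),
      (univ.filter fun f : Fin n × Fin d → Fin n =>
        ∀ c ∈ S ×ˢ univ, f c ∈ (S.erase c.1)ᶜ).card := by
    simp only [ind, card_filter, sum_filter]
    rw [sum_comm]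
    refine sum_congr rfl fun U _ => ?_
    by_cases h : U.card = s <;> simp [h]
  rw [e, sum_mul]
  calc _ = ∑ S ∈ univ.filter (fun U : Finset (Fin n) => U.card = s), (n - (s-1))^(s*d) * M := by
        refine sum_congr rfl fun S hS => ?_
        simp only [mem_filter, mem_univ, true_and] at hS
        have := count_fun (S ×ˢ (univ : Finset (Fin d))) (fun c => (S.erase c.1)ᶜ)
        rw [prod_congr rfl (g := fun _ => n - (s-1))] at this
        · simp only [prod_const, card_product, hS, card_univ, Fintype.card_fin] at this
          rw [this, hM']
        · intro c hc
          rw [card_compl, card_erase_of_mem (mem_product.1 hc).1, hS, Fintype.card_fin]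
    _ ≤ _ := by
        rw [sum_const, smul_eq_mul, mul_assoc]
        gcongr
        refine (card_le_univ _).trans ?_
        simp

lemma exists_fun (k : ℕ) (α : ℝ) (hα : 0 < α) (hα1 : α ≤ 1) : ∃ d B N : ℕ, ∀ n, N ≤ n →
    ∃ f : Fin n × Fin d → Fin n, ind (⌈α * n⌉₊) f = ∅ ∧ (bad k f).card ≤ B := by
  obtain ⟨d, hd⟩ := exists_nat_ge (4 / α^2)
  set B := (k+1) * (2 ^ (k*d) * (k+1)^k) with hB
  have hB0 : 0 < B := by positivity
  obtain ⟨N, hN⟩ := exists_nat_ge (2 / α)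
  refine ⟨d, 2*B, N+1, fun n hn => ?_⟩
  have hn0 : 0 < n := by omega
  have hnr : (0:ℝ) < n := by exact_mod_cast hn0
  set s := ⌈α * n⌉₊ with hs
  have hs1 : 1 ≤ s := Nat.one_le_iff_ne_zero.2 (Nat.ceil_pos.2 (by positivity)).ne'
  have hsn : s ≤ n := Nat.ceil_le.2 (by nlinarith)
  have hsα : α * n ≤ s := Nat.le_ceil _
  have hαn : 2 ≤ α * n := by
    have : (N:ℝ) ≤ n := by exact_mod_cast (by omega : N ≤ n)
    have : 2 / α ≤ n := hN.trans this
    rw [div_le_iff₀ hα] at this; linarith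
  set M := Fintype.card (Fin n × Fin d → Fin n) with hM
  have hMp : (0:ℝ) < M := by
    have : 0 < M := by simp [hM]; positivity
    exact_mod_cast this
  have h1 := sum_bad k n d hn0
  have h2 := sum_ind n d s hs1 hsn
  rw [← hM] at h1 h2
  set Y := ∑ f : Fin n × Fin d → Fin n, (ind s f).card with hY
  set Z := ∑ f : Fin n × Fin d → Fin n, (bad k f).card with hZ
  have h3 : (Y:ℝ) * 2 < M := by
    have h2' : (Y:ℝ) * n ^ (s*d) ≤ 2^n * ((n:ℝ) - (s-1)) ^ (s*d) * M := by
      have : ((Y * n^(s*d) : ℕ):ℝ) ≤ ((2 ^ n * (n - (s - 1)) ^ (s*d) * M : ℕ) : ℝ) := by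
        exact_mod_cast h2
      push_cast [Nat.cast_sub (show s - 1 ≤ n by omega), Nat.cast_sub hs1] at this
      exact this
    have h4 : ((n:ℝ) - (s-1)) ≤ n * Real.exp (-(α/2)) := by
      have := Real.add_one_le_exp (-(α/2))
      nlinarith
    have h5 : ((n:ℝ) - (s-1)) ^ (s*d) ≤ n^(s*d) * Real.exp (-(2*n)) := by
      have h0 : (0:ℝ) ≤ (n:ℝ) - (s-1) := by
        have : (s:ℝ) ≤ n := by exact_mod_cast hsn
        linarith
      calc _ ≤ (n * Real.exp (-(α/2))) ^ (s*d) := pow_le_pow_left₀ h0 h4 _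
        _ = n^(s*d) * Real.exp ((s*d:ℕ) * (-(α/2))) := by rw [mul_pow, ← Real.exp_nat_mul]
        _ ≤ _ := by
          gcongr
          push_cast
          have : 4 ≤ d * α^2 := by rwa [div_le_iff₀ (by positivity)] at hd
          have h6 : α * n * d * α ≤ s * d * α := by gcongr
          nlinarith
    have h6 : (2:ℝ)^n ≤ Real.exp n := by
      have : (2:ℝ) ≤ Real.exp 1 := by have := Real.add_one_le_exp (1:ℝ); linarith
      calc (2:ℝ)^n ≤ (Real.exp 1)^n := by gcongr
        _ = _ := by rw [← Real.exp_nat_mul, mul_one]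
    have h7 : (Y:ℝ) * n^(s*d) ≤ (Real.exp (-n) * M) * n^(s*d) := by
      calc _ ≤ _ := h2'
        _ ≤ Real.exp n * (n^(s*d) * Real.exp (-(2*n))) * M := by
            refine mul_le_mul_of_nonneg_right ?_ hMp.le
            refine (mul_le_mul_of_nonneg_left h5 (by positivity)).trans ?_
            gcongr
        _ = (Real.exp n * Real.exp (-(2*n)) * M) * n^(s*d) := by ring
        _ = _ := by rw [← Real.exp_add]; ring_nf
    have h8 : (Y:ℝ) ≤ Real.exp (-n) * M := le_of_mul_le_mul_right h7 (by positivity)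
    have h9 : Real.exp (-(n:ℝ)) * 2 < 1 := by
      rw [Real.exp_neg]
      have : (2:ℝ) < Real.exp n := by
        have := Real.add_one_le_exp (n:ℝ)
        have : (2:ℝ) ≤ n := by nlinarith
        linarith
      rw [inv_mul_lt_iff₀ (Real.exp_pos _)]; linarith
    nlinarith
  have h3' : Y * 2 < M := by exact_mod_cast h3
  by_contra hcon
  push Not at hcon
  have h4 : ∀ f : Fin n × Fin d → Fin n, 2*B ≤ 2*B*(ind s f).card + (bad k f).card := by
    intro f
    by_cases h : ind s f = ∅
    · have := hcon f h; omega
    · have : 1 ≤ (ind s f).card := card_pos.2 (nonempty_iff_ne_empty.2 h)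
      nlinarith
  have h5 := sum_le_sum (fun f (_ : f ∈ (univ : Finset (Fin n × Fin d → Fin n))) => h4 f)
  rw [sum_add_distrib, sum_const, card_univ, ← hM, smul_eq_mul, ← mul_sum, ← hY, ← hZ] at h5
  rw [← hB] at h1
  nlinarith

lemma erdos (k : ℕ) (α : ℝ) (hα : 0 < α) : ∃ N : ℕ, ∀ n, N ≤ n → ∃ H : SimpleGraph (Fin n),
    (∀ v (c : H.Walk v v), c.IsCycle → k < c.length) ∧
    ∀ S : Finset (Fin n), (∀ u ∈ S, ∀ v ∈ S, ¬ H.Adj u v) → (S.card : ℝ) ≤ α * n := by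
  set β := min (α/2) 1 with hβ
  have hβ0 : 0 < β := by positivity
  obtain ⟨d, B, N, h⟩ := exists_fun k β hβ0 (min_le_right _ _)
  obtain ⟨N', hN'⟩ := exists_nat_ge ((B*k+1) / (α/2))
  refine ⟨N + N', fun n hn => ?_⟩
  obtain ⟨f, hf1, hf2⟩ := h n (by omega)
  set W := (bad k f).biUnion id with hW
  have hWc : W.card ≤ B * k := by
    refine (card_biUnion_le_card_mul _ _ k fun U hU => ?_).trans (Nat.mul_le_mul_right _ hf2)
    exact (mem_filter.1 hU).2.1
  let H : SimpleGraph (Fin n) :=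
    { Adj := fun u v => u ≠ v ∧ u ∉ W ∧ v ∉ W ∧ ∃ i, f (u,i) = v ∨ f (v,i) = u
      symm := ⟨fun u v ⟨h1, h2, h3, i, h4⟩ => ⟨h1.symm, h3, h2, i, h4.symm⟩⟩
      loopless := ⟨fun u hu => hu.1 rfl⟩ }
  refine ⟨H, fun v c hc => ?_, fun S hS => ?_⟩
  · by_contra hlen
    push Not at hlen
    set U := c.support.tail.toFinset with hU
    have hUc : U.card = c.length := by
      rw [hU, List.toFinset_card_of_nodup hc.support_nodup]; simp
    have hmem : ∀ x ∈ c.support, x ∈ U := by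
      intro x hx
      rw [hU, List.mem_toFinset]
      rw [SimpleGraph.Walk.mem_support_iff] at hx
      rcases hx with rfl | hx
      · exact SimpleGraph.Walk.end_mem_tail_support hc.not_nil
      · exact hx
    have hE : c.edges.toFinset ⊆ (((U ×ˢ (univ : Finset (Fin d))).filter fun c => f c ∈ U)).image
        (fun c => s(c.1, f c)) := by
      intro e he
      rw [List.mem_toFinset] at he
      induction e using Sym2.ind with
      | _ x y =>
        have hx := hmem x (c.fst_mem_support_of_mem_edges he)
        have hy := hmem y (c.snd_mem_support_of_mem_edges he)
        obtain ⟨-, -, -, i, h1 | h1⟩ : H.Adj x y := c.adj_of_mem_edges he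
        · exact mem_image.2 ⟨(x,i), by simp [hx, hy, h1], by simp [h1]⟩
        · exact mem_image.2 ⟨(y,i), by simp [hx, hy, h1], by simp [h1, Sym2.eq_swap]⟩
    have h2 := (card_le_card hE).trans card_image_le
    rw [List.toFinset_card_of_nodup hc.edges_nodup, SimpleGraph.Walk.length_edges, ← hUc] at h2
    have hUbad : U ∈ bad k f := by
      simp only [bad, mem_filter, mem_univ, true_and]
      exact ⟨by omega, h2⟩
    have hvW : v ∈ W := mem_biUnion.2 ⟨U, hUbad, hmem v (by simp)⟩
    cases c with
    | nil => exact hc.not_nil (by simp)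
    | cons hadj p => exact hadj.2.1 hvW
  · have h1 : (S \ W).card < ⌈β * n⌉₊ := by
      by_contra hcon
      push Not at hcon
      obtain ⟨S', hS', hc⟩ := exists_subset_card_eq hcon
      have : S' ∈ ind ⌈β * n⌉₊ f := by
        simp only [ind, mem_filter, mem_univ, true_and]
        refine ⟨hc, fun c hcm => ?_⟩
        rw [mem_compl, mem_erase]
        rintro ⟨h1, h2⟩
        have h3 := mem_sdiff.1 (hS' (mem_product.1 hcm).1)
        have h4 := mem_sdiff.1 (hS' h2)
        exact hS _ h3.1 _ h4.1 ⟨h1.symm, h3.2, h4.2, c.2, Or.inl rfl⟩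
      rw [hf1] at this
      simp at this
    have h2 : S.card ≤ (S \ W).card + W.card := by
      rw [← card_sdiff_add_card_inter S W]
      gcongr; exact inter_subset_right
    have h3 : (((S \ W).card : ℕ) : ℝ) < β * n := Nat.lt_ceil.1 h1
    have h4 : (S.card : ℝ) ≤ (S \ W).card + B * k := by
      exact_mod_cast h2.trans (by gcongr)
    have h5 : ((B:ℝ)*k+1) ≤ n * (α/2) := by
      rw [div_le_iff₀ (by positivity)] at hN'
      refine hN'.trans ?_
      gcongr
      omega
    have h6 : β * n ≤ α/2 * n := by gcongr; exact min_le_left _ _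
    linarith

lemma gamma_lt (k : ℕ) (hk : 3 ≤ k) (F : SimpleGraph (Fin k)) : gammaAcyclic F < k := by
  have : gammaAcyclic F ≤ k - 1 := by
    refine Nat.sInf_le ⟨univ.erase ⟨0, by omega⟩, by simp [card_erase_of_mem], ?_⟩
    have hsub : Subsingleton
        (((univ.erase (⟨0, by omega⟩ : Fin k) : Finset (Fin k)) : Set (Fin k))ᶜ : Set (Fin k)) := by
      constructor
      rintro ⟨a, ha⟩ ⟨b, hb⟩
      simp at ha hb
      simp [ha, hb]
    intro v c hc
    cases c with
    | nil => exact hc.not_nil (by simp)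
    | cons hadj p => exact hadj.ne (Subsingleton.elim _ _)
  omega

lemma gamma_le {k n : ℕ} (F : SimpleGraph (Fin k)) (H G : SimpleGraph (Fin n))
    (A : Finset (Fin n))
    (hG : ∀ u v, G.Adj u v → u ∉ A → v ∉ A → H.Adj u v)
    (hH : ∀ v (c : H.Walk v v), c.IsCycle → k < c.length)
    (S : Finset (Fin n)) (hS : SpansCopy F G S) : gammaAcyclic F ≤ (S ∩ A).card := by
  obtain ⟨f, hf, hadj, rfl⟩ := hS
  have h1 : (univ.filter fun a => f a ∈ A).card ≤ (Finset.image f univ ∩ A).card := by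
    rw [← card_image_of_injective _ hf]
    refine card_le_card fun x hx => ?_
    simp only [mem_image, mem_filter, mem_univ, true_and] at hx
    obtain ⟨a, ha, rfl⟩ := hx
    simp [ha]
  refine le_trans (Nat.sInf_le ⟨_, rfl, ?_⟩) h1
  intro v c hc
  let φ : F.induce (((univ.filter fun a => f a ∈ A : Finset (Fin k)) : Set (Fin k))ᶜ) →g H :=
    { toFun := fun a => f a.1
      map_rel' := by
        intro a b hab
        refine hG _ _ (hadj _ _ hab) ?_ ?_
        · simpa using a.2
        · simpa using b.2 }
  have hφ : Function.Injective φ := fun a b hab => Subtype.ext (hf hab)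
  have h2 := hH _ (c.map φ) (hc.map hφ)
  rw [SimpleGraph.Walk.length_map] at h2
  have h3 := hc.support_nodup.length_le_card
  have h4 : c.support.tail.length = c.length := by simp
  have h5 := Fintype.card_subtype_le
    (fun x => x ∈ (((univ.filter fun a => f a ∈ A : Finset (Fin k)) : Set (Fin k))ᶜ))
  have h6 : Fintype.card
    (((univ.filter fun a => f a ∈ A : Finset (Fin k)) : Set (Fin k))ᶜ : Set (Fin k)) ≤ k := by
    simpa using Fintype.card_le_of_injective
      (fun a : (((univ.filter fun a => f a ∈ A : Finset (Fin k)) : Set (Fin k))ᶜ : Set (Fin k)) =>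
        a.1) Subtype.val_injective
  omega

end RTTAux

open RTT in
/-- For every `k ≥ 3`, every `k`-vertex graph `F` containing a cycle, every
`0 < η < γ(F)/k` and every `α > 0`, for all sufficiently large `n` there is an `n`-vertex
graph `G` with `δ(G) ≥ ηn` and `α(G) ≤ αn` in which every `F`-tiling covers at most
`(1-μ)n` vertices, where `μ = γ(F)/k - η`. -/
theorem lower_bound_alpha_two :
    ∀ k : ℕ, 3 ≤ k → ∀ F : SimpleGraph (Fin k), ¬ F.IsAcyclic →
    ∀ η α : ℝ, 0 < η → η < (gammaAcyclic F : ℝ) / (k : ℝ) → 0 < α →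
    ∃ N : ℕ, ∀ n : ℕ, N ≤ n →
      ∃ G : SimpleGraph (Fin n),
        MinDegGE G (η * n) ∧ IndepBound G 2 (α * n) ∧
        ∀ T : Finset (Finset (Fin n)), IsTiling F G T →
          ((T.biUnion id).card : ℝ) ≤ (1 - ((gammaAcyclic F : ℝ) / (k : ℝ) - η)) * n := by
  intro k hk F _ η α hη hηx hα
  set g := gammaAcyclic F with hg
  have hgk : g < k := RTTAux.gamma_lt k hk F
  have hk0 : (0:ℝ) < k := by exact_mod_cast (by omega : 0 < k)
  set x : ℝ := (g:ℝ) / k with hx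
  have hx1 : x < 1 := by rw [hx, div_lt_one hk0]; exact_mod_cast hgk
  have hx0 : 0 < x := hη.trans hηx
  obtain ⟨N1, hN1⟩ := RTTAux.erdos k α hα
  have hε : 0 < (x - η) * (1 - x) := mul_pos (by linarith) (by linarith)
  obtain ⟨N2, hN2⟩ := exists_nat_ge (1 / ((x - η) * (1 - x)))
  obtain ⟨N3, hN3⟩ := exists_nat_ge (1 / (1 - η))
  refine ⟨N1 + N2 + N3, fun n hn => ?_⟩
  obtain ⟨H, hH1, hH2⟩ := hN1 n (by omega)
  have hn2 : 1 ≤ n * ((x - η) * (1 - x)) := by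
    rw [div_le_iff₀ hε] at hN2
    refine hN2.trans ?_
    gcongr; omega
  have hn3 : 1 ≤ n * (1 - η) := by
    have h1η : 0 < 1 - η := by linarith
    rw [div_le_iff₀ h1η] at hN3
    refine hN3.trans ?_
    gcongr; omega
  have hmn : ⌈η * n⌉₊ ≤ n := Nat.ceil_le.2 (by nlinarith)
  obtain ⟨A, -, hA⟩ := exists_subset_card_eq (s := (univ : Finset (Fin n)))
    (n := ⌈η * n⌉₊) (by rw [card_univ, Fintype.card_fin]; exact hmn)
  let G : SimpleGraph (Fin n) :=
    { Adj := fun u v => u ≠ v ∧ (u ∈ A ∨ v ∈ A ∨ H.Adj u v)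
      symm := ⟨fun u v ⟨h1, h2⟩ => ⟨h1.symm, by
        rcases h2 with h | h | h
        · exact Or.inr (Or.inl h)
        · exact Or.inl h
        · exact Or.inr (Or.inr h.symm)⟩⟩
      loopless := ⟨fun u hu => hu.1 rfl⟩ }
  refine ⟨G, fun v => ?_, fun S hS => ?_, fun T hT => ?_⟩
  · by_cases hv : v ∈ A
    · have h1 : ((univ.erase v : Finset (Fin n)) : Set (Fin n)) ⊆ G.neighborSet v := by
        intro u hu
        have : u ≠ v := by simpa using hu
        exact ⟨this.symm, Or.inl hv⟩
      have h2 := Set.ncard_le_ncard h1 (Set.toFinite _)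
      rw [Set.ncard_coe_finset, card_erase_of_mem (mem_univ _), card_univ, Fintype.card_fin] at h2
      have h3 : (n:ℝ) ≤ (G.neighborSet v).ncard + 1 := by exact_mod_cast (by omega)
      linarith
    · have h1 : (A : Set (Fin n)) ⊆ G.neighborSet v := by
        intro u hu
        have hu' : u ∈ A := hu
        exact ⟨fun h => hv (h ▸ hu'), Or.inr (Or.inl hu')⟩
      have h2 := Set.ncard_le_ncard h1 (Set.toFinite _)
      rw [Set.ncard_coe_finset, hA] at h2
      exact (Nat.le_ceil _).trans (by exact_mod_cast h2)
  · refine hH2 S fun u hu v hv huv => ?_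
    refine hS {u, v} (by intro z hz; simp at hz; rcases hz with rfl | rfl <;> assumption) ?_
    rw [SimpleGraph.isNClique_iff]
    have hGa : G.Adj u v := ⟨huv.ne, Or.inr (Or.inr huv)⟩
    exact ⟨by simp [SimpleGraph.isClique_pair, hGa], card_pair huv.ne⟩
  · have h1 : ∀ S ∈ T, g ≤ (S ∩ A).card := fun S hS =>
      RTTAux.gamma_le F H G A (fun u v huv hu hv => by
        rcases huv.2 with h | h | h
        · exact absurd h hu
        · exact absurd h hv
        · exact h) hH1 S (hT.1 S hS)
    have h2 : T.card * g ≤ A.card := by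
      calc T.card * g = ∑ S ∈ T, g := by simp
        _ ≤ ∑ S ∈ T, (S ∩ A).card := sum_le_sum h1
        _ = (T.biUnion fun S => S ∩ A).card := by
          rw [card_biUnion]
          intro S hS S' hS' hne
          exact (hT.2 S hS S' hS' hne).mono inter_subset_left inter_subset_left
        _ ≤ A.card := card_le_card (biUnion_subset.2 fun S _ => inter_subset_right)
    have h3 : (T.biUnion id).card ≤ T.card * k := by
      refine card_biUnion_le_card_mul _ _ _ fun S hS => ?_
      obtain ⟨f, -, -, rfl⟩ := hT.1 S hS
      exact card_image_le.trans (by simp)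
    have h4 : ((T.biUnion id).card : ℝ) ≤ T.card * k := by exact_mod_cast h3
    have h5 : (T.card : ℝ) * g ≤ ⌈η * n⌉₊ := by rw [← hA]; exact_mod_cast h2
    have h6 : (⌈η * n⌉₊ : ℝ) < η * n + 1 := Nat.ceil_lt_add_one (by positivity)
    have hgx : (g:ℝ) = x * k := by rw [hx]; field_simp
    have h7 : x * (T.card * k) ≤ x * ((1 - (x - η)) * n) := by
      rw [hgx] at h5
      nlinarith
    exact h4.trans (le_of_mul_le_mul_left h7 hx0)
end
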